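/- arXiv:0803.1313 — 3 statements merged into one kernel-verified Lean document; each statement's English description precedes it below -/
import Mathlib

section
/- Fix n ≥ 1 and λ > 0. On the punctured open cylinder {(z,t) ∈ ℝ^{2n+1} : 0 < |z| < 1/λ} define, with g(ρ) := √(1−λ²ρ²)/ρ, the functions aᵢ(z) := −λxᵢ − g(|z|)yᵢ and bᵢ(z) := −λyᵢ + g(|z|)xᵢ (i = 1,…,n). Then (i) Σᵢ (aᵢ² + bᵢ²) = 1 at every point, and (ii) the horizontal divergence is constant: Σᵢ (∂aᵢ/∂xᵢ + yᵢ ∂aᵢ/∂t + ∂bᵢ/∂yᵢ − xᵢ ∂bᵢ/∂t) = −2nλ. (Since aᵢ, bᵢ do not depend on t, this also equals the Euclidean divergence of the coordinate vector field Σᵢ aᵢ(∂/∂xᵢ + yᵢ∂/∂t) + bᵢ(∂/∂yᵢ − xᵢ∂/∂t).) -/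
open MeasureTheory Real Filter Set
open scoped BigOperators ENNReal NNReal Topology

noncomputable section

/-- The Heisenberg group `ℍⁿ` modeled as `ℝⁿ × ℝⁿ × ℝ`, coordinates `(x, y, t)`. -/
abbrev Hei (n : ℕ) : Type := (Fin n → ℝ) × (Fin n → ℝ) × ℝ

/-- Euclidean norm of the horizontal component `z = (x,y)` of a point. -/
def zNorm {n : ℕ} (p : Hei n) : ℝ := Real.sqrt (∑ i, ((p.1 i) ^ 2 + (p.2.1 i) ^ 2))

/-- Derivative along the left-invariant frame field `Xᵢ = ∂/∂xᵢ + yᵢ ∂/∂t`. -/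
def Xder {n : ℕ} (F : Hei n → ℝ) (i : Fin n) (p : Hei n) : ℝ :=
  fderiv ℝ F p (Pi.single i 1, 0, 0) + p.2.1 i * fderiv ℝ F p (0, 0, 1)

/-- Derivative along the left-invariant frame field `Yᵢ = ∂/∂yᵢ − xᵢ ∂/∂t`. -/
def Yder {n : ℕ} (F : Hei n → ℝ) (i : Fin n) (p : Hei n) : ℝ :=
  fderiv ℝ F p (0, Pi.single i 1, 0) - p.1 i * fderiv ℝ F p (0, 0, 1)

/-- Horizontal divergence of the horizontal field with frame coefficients `(a, b)`. -/
def hDivergence {n : ℕ} (a b : Hei n → Fin n → ℝ) (p : Hei n) : ℝ :=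
  ∑ i, (Xder (fun q => a q i) i p + Yder (fun q => b q i) i p)

/-- Admissible test fields for the horizontal perimeter in an open set `Ω`:
`C¹` with compact support in `Ω` and pointwise length at most `1`. -/
def IsAdmissible {n : ℕ} (Ω : Set (Hei n)) (a b : Hei n → Fin n → ℝ) : Prop :=
  ContDiff ℝ 1 a ∧ ContDiff ℝ 1 b ∧ HasCompactSupport a ∧ HasCompactSupport b ∧
  tsupport a ⊆ Ω ∧ tsupport b ⊆ Ω ∧ ∀ p, ∑ i, ((a p i) ^ 2 + (b p i) ^ 2) ≤ 1

/-- Horizontal (sub-Riemannian) perimeter of `E` relative to the open set `Ω`. -/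
def hPerimeter {n : ℕ} (E Ω : Set (Hei n)) : ℝ≥0∞ :=
  ⨆ ab : {ab : (Hei n → Fin n → ℝ) × (Hei n → Fin n → ℝ) // IsAdmissible Ω ab.1 ab.2},
    ENNReal.ofReal (∫ p in E, hDivergence ab.1.1 ab.1.2 p)

/-- Profile function `f_λ` of the Pansu sphere. -/
def pansuProfile (lam ρ : ℝ) : ℝ :=
  (1 / (2 * lam ^ 2)) * (lam * ρ * Real.sqrt (1 - lam ^ 2 * ρ ^ 2) + Real.arccos (lam * ρ))

/-- The Pansu ball `B_λ`. -/
def pansuBall (n : ℕ) (lam : ℝ) : Set (Hei n) :=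
  {p | zNorm p ≤ 1 / lam ∧ |p.2.2| ≤ pansuProfile lam (zNorm p)}

/-- The Pansu sphere `S_λ = ∂B_λ`. -/
def pansuSphere (n : ℕ) (lam : ℝ) : Set (Hei n) :=
  {p | zNorm p ≤ 1 / lam ∧
    (p.2.2 = pansuProfile lam (zNorm p) ∨ p.2.2 = -pansuProfile lam (zNorm p))}

/-- The closed vertical cylinder `C_r` over the disk of radius `r`. -/
def cylinder (n : ℕ) (r : ℝ) : Set (Hei n) := {p | zNorm p ≤ r}

/-- The closed horizontal disk `D_r` in the hyperplane `{t = 0}`. -/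
def disk (n : ℕ) (r : ℝ) : Set (Hei n) := {p | zNorm p ≤ r ∧ p.2.2 = 0}

/-- `p` is a point of Lebesgue density one of `E`. -/
def DensityOnePoint {n : ℕ} (E : Set (Hei n)) (p : Hei n) : Prop :=
  Tendsto (fun ρ => volume (E ∩ Metric.closedBall p ρ) / volume (Metric.closedBall p ρ))
    (nhdsWithin 0 (Set.Ioi 0)) (nhds 1)

lemma hasFDerivAt_sumSq {n : ℕ} (p : Hei n) :
    HasFDerivAt (fun q : Hei n => ∑ i, ((q.1 i) ^ 2 + (q.2.1 i) ^ 2))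
      (∑ i, ((2 * p.1 i) • ((ContinuousLinearMap.proj i : (Fin n → ℝ) →L[ℝ] ℝ).comp
          (ContinuousLinearMap.fst ℝ (Fin n → ℝ) ((Fin n → ℝ) × ℝ))) +
        (2 * p.2.1 i) • ((ContinuousLinearMap.proj i : (Fin n → ℝ) →L[ℝ] ℝ).comp
          ((ContinuousLinearMap.fst ℝ (Fin n → ℝ) ℝ).comp
            (ContinuousLinearMap.snd ℝ (Fin n → ℝ) ((Fin n → ℝ) × ℝ)))))) p := by
  apply HasFDerivAt.fun_sum
  intro i _
  have h1 := (((ContinuousLinearMap.proj i : (Fin n → ℝ) →L[ℝ] ℝ).comp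
          (ContinuousLinearMap.fst ℝ (Fin n → ℝ) ((Fin n → ℝ) × ℝ))).hasFDerivAt (x := p)).pow 2
  have h2 := (((ContinuousLinearMap.proj i : (Fin n → ℝ) →L[ℝ] ℝ).comp
          ((ContinuousLinearMap.fst ℝ (Fin n → ℝ) ℝ).comp
            (ContinuousLinearMap.snd ℝ (Fin n → ℝ) ((Fin n → ℝ) × ℝ)))).hasFDerivAt (x := p)).pow 2
  refine (h1.add h2).congr_fderiv ?_
  ext v <;> simp

/-- The calibration field: on `{0 < |z| < 1/λ}`, with
`g(ρ) = √(1−λ²ρ²)/ρ`, `aᵢ = −λxᵢ − g(|z|)yᵢ`, `bᵢ = −λyᵢ + g(|z|)xᵢ`, the field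
`Σᵢ aᵢXᵢ + bᵢYᵢ` is a unit horizontal field with constant horizontal divergence
`−2nλ`. -/
theorem calibration_field_unit_and_divergence
    (n : ℕ) (hn : 1 ≤ n) (lam : ℝ) (hlam : 0 < lam)
    (g : ℝ → ℝ) (hg : ∀ ρ, g ρ = Real.sqrt (1 - lam ^ 2 * ρ ^ 2) / ρ)
    (a b : Hei n → Fin n → ℝ)
    (ha : ∀ p i, a p i = -lam * p.1 i - g (zNorm p) * p.2.1 i)
    (hb : ∀ p i, b p i = -lam * p.2.1 i + g (zNorm p) * p.1 i)
    (p : Hei n) (hp0 : 0 < zNorm p) (hp1 : zNorm p < 1 / lam) :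
    (∑ i, ((a p i) ^ 2 + (b p i) ^ 2) = 1) ∧
    hDivergence a b p = -(2 * n * lam) := by
  have hz : ∀ q : Hei n, zNorm q ^ 2 = ∑ i, ((q.1 i) ^ 2 + (q.2.1 i) ^ 2) := fun q =>
    Real.sq_sqrt (Finset.sum_nonneg fun i _ => by positivity)
  have hlt : 0 < 1 - lam ^ 2 * zNorm p ^ 2 := by
    have h : lam * zNorm p < 1 := by
      have := (lt_div_iff₀ hlam).1 hp1
      linarith
    have h0 : 0 < lam * zNorm p := by positivity
    nlinarith
  constructor
  · have h1 : ∑ i, ((a p i) ^ 2 + (b p i) ^ 2) = (lam ^ 2 + g (zNorm p) ^ 2) * zNorm p ^ 2 := by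
      rw [hz, Finset.mul_sum]
      refine Finset.sum_congr rfl fun i _ => ?_
      rw [ha, hb]; ring
    rw [h1, hg, div_pow, Real.sq_sqrt hlt.le]
    field_simp
    ring
  · obtain ⟨c, hc⟩ : ∃ c, HasDerivAt
        (fun s => Real.sqrt (1 - lam ^ 2 * s) / Real.sqrt s) c
        (∑ i, ((p.1 i) ^ 2 + (p.2.1 i) ^ 2)) := by
      rw [← hz]
      refine ⟨_, DifferentiableAt.hasDerivAt ?_⟩
      refine DifferentiableAt.div ?_ ?_ ?_
      · exact DifferentiableAt.sqrt (by fun_prop) hlt.ne'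
      · exact DifferentiableAt.sqrt (by fun_prop) (by positivity)
      · rw [Real.sqrt_sq hp0.le]; exact hp0.ne'
    have hG := hc.comp_hasFDerivAt p (hasFDerivAt_sumSq p)
    have hGe : ((fun s => Real.sqrt (1 - lam ^ 2 * s) / Real.sqrt s) ∘
        fun q : Hei n => ∑ i, ((q.1 i) ^ 2 + (q.2.1 i) ^ 2)) = fun q => g (zNorm q) := by
      funext q
      simp only [Function.comp, hg, hz]
      rfl
    rw [hGe] at hG
    have key : ∀ i, Xder (fun q => a q i) i p + Yder (fun q => b q i) i p = -(2 * lam) := by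
      intro i
      have h1 := ((ContinuousLinearMap.proj i : (Fin n → ℝ) →L[ℝ] ℝ).comp
          (ContinuousLinearMap.fst ℝ (Fin n → ℝ) ((Fin n → ℝ) × ℝ))).hasFDerivAt (x := p)
      have h2 := ((ContinuousLinearMap.proj i : (Fin n → ℝ) →L[ℝ] ℝ).comp
          ((ContinuousLinearMap.fst ℝ (Fin n → ℝ) ℝ).comp
            (ContinuousLinearMap.snd ℝ (Fin n → ℝ) ((Fin n → ℝ) × ℝ)))).hasFDerivAt (x := p)
      have hA := (h1.const_mul (-lam)).sub (hG.mul h2)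
      have hB := (h2.const_mul (-lam)).add (hG.mul h1)
      have hA' := HasFDerivAt.fderiv (f := fun q => a q i)
        (hA.congr_of_eventuallyEq (Eventually.of_forall fun q => ha q i))
      have hB' := HasFDerivAt.fderiv (f := fun q => b q i)
        (hB.congr_of_eventuallyEq (Eventually.of_forall fun q => hb q i))
      unfold Xder Yder
      rw [hA', hB']
      simp [Pi.single_apply]
      ring
    unfold hDivergence
    rw [Finset.sum_congr rfl fun i _ => key i]
    simp
    ring

end
end

section
/- Fix n ≥ 1, λ > 0, and A, B ∈ ℝⁿ with Σᵢ (Aᵢ² + Bᵢ²) = 1. Let γ(s) = (x(s), y(s), t(s)) be the geodesic of curvature λ with γ(0) = (0, −π/(4λ²)) and (ẋᵢ(0), ẏᵢ(0)) = (Aᵢ, Bᵢ), and write z(s) = (x(s), y(s)). Then t(s) = −f_λ(|z(s)|) for all s ∈ [0, π/(2λ)], and t(s) = f_λ(|z(s)|) for all s ∈ [π/(2λ), π/λ]. In particular γ([0, π/λ]) ⊂ S_λ, γ(0) is the south pole (0, −π/(4λ²)) and γ(π/λ) is the north pole (0, π/(4λ²)) of S_λ. -/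
open MeasureTheory Real Filter Set
open scoped BigOperators ENNReal NNReal Topology

noncomputable section

lemma pansu_aux_unique (lam a b : ℝ) (hlam : 0 < lam) (x y : ℝ → ℝ)
    (hx : ContDiff ℝ 2 x) (hy : ContDiff ℝ 2 y)
    (hxeq : ∀ s, deriv (deriv x) s = 2 * lam * deriv y s)
    (hyeq : ∀ s, deriv (deriv y) s = -(2 * lam) * deriv x s)
    (hx0 : x 0 = 0) (hy0 : y 0 = 0) (ha : deriv x 0 = a) (hb : deriv y 0 = b) :
    ∀ s, (x s = (a * sin (2 * lam * s) + b * (1 - cos (2 * lam * s))) / (2 * lam) ∧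
      y s = (b * sin (2 * lam * s) - a * (1 - cos (2 * lam * s))) / (2 * lam)) ∧
      (deriv x s = a + 2 * lam * y s ∧ deriv y s = b - 2 * lam * x s) := by
  have dx : ∀ s, HasDerivAt x (deriv x s) s := fun s =>
    (hx.differentiable (by norm_num) s).hasDerivAt
  have dy : ∀ s, HasDerivAt y (deriv y s) s := fun s =>
    (hy.differentiable (by norm_num) s).hasDerivAt
  have hx' : Differentiable ℝ (deriv x) := by
    have : ContDiff ℝ 1 (deriv x) := ContDiff.deriv' (n := 1) (by simpa [one_add_one_eq_two] using hx)
    exact this.differentiable (by norm_num)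
  have hy' : Differentiable ℝ (deriv y) := by
    have : ContDiff ℝ 1 (deriv y) := ContDiff.deriv' (n := 1) (by simpa [one_add_one_eq_two] using hy)
    exact this.differentiable (by norm_num)
  have ddx : ∀ s, HasDerivAt (deriv x) (2 * lam * deriv y s) s := fun s => by
    rw [← hxeq]; exact (hx' s).hasDerivAt
  have ddy : ∀ s, HasDerivAt (deriv y) (-(2 * lam) * deriv x s) s := fun s => by
    rw [← hyeq]; exact (hy' s).hasDerivAt
  have const : ∀ g : ℝ → ℝ, (∀ s, HasDerivAt g 0 s) → ∀ s, g s = g 0 := fun g hg s =>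
    is_const_of_deriv_eq_zero (fun u => (hg u).differentiableAt) (fun u => (hg u).deriv) s 0
  have ex : ∀ s, deriv x s = a + 2 * lam * y s := by
    intro s
    have := const (fun u => deriv x u - 2 * lam * y u)
      (fun u => ((ddx u).sub ((dy u).const_mul (2 * lam))).congr_deriv (by ring)) s
    simp only [hy0, ha] at this
    linarith
  have ey : ∀ s, deriv y s = b - 2 * lam * x s := by
    intro s
    have := const (fun u => deriv y u + 2 * lam * x u)
      (fun u => ((ddy u).add ((dx u).const_mul (2 * lam))).congr_deriv (by ring)) s
    simp only [hx0, hb] at this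
    linarith
  have hs : ∀ s, HasDerivAt (fun u => sin (2 * lam * u)) (cos (2 * lam * s) * (2 * lam)) s :=
    fun s => by
      simpa using ((hasDerivAt_id s).const_mul (2 * lam)).sin
  have hc : ∀ s, HasDerivAt (fun u => cos (2 * lam * u)) (-sin (2 * lam * s) * (2 * lam)) s :=
    fun s => by
      simpa using ((hasDerivAt_id s).const_mul (2 * lam)).cos
  intro s
  refine ⟨?_, ex s, ey s⟩
  have hE := const (fun u =>
      (2 * lam * x u - (a * sin (2 * lam * u) + b * (1 - cos (2 * lam * u)))) ^ 2
      + (2 * lam * y u - (b * sin (2 * lam * u) - a * (1 - cos (2 * lam * u)))) ^ 2)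
    (fun u => by
      have h1 := ((dx u).const_mul (2 * lam)).sub
        (((hs u).const_mul a).add (((hc u).const_sub 1).const_mul b))
      have h2 := ((dy u).const_mul (2 * lam)).sub
        (((hs u).const_mul b).sub (((hc u).const_sub 1).const_mul a))
      refine ((h1.pow 2).add (h2.pow 2)).congr_deriv ?_
      simp only [Pi.sub_apply, Pi.add_apply, ex, ey]
      push_cast
      ring) s
  simp only [hx0, hy0, mul_zero, sin_zero, cos_zero, sub_self, add_zero] at hE
  have e1 : 2 * lam * x s - (a * sin (2 * lam * s) + b * (1 - cos (2 * lam * s))) = 0 := by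
    nlinarith [sq_nonneg (2 * lam * x s - (a * sin (2 * lam * s) + b * (1 - cos (2 * lam * s)))),
      sq_nonneg (2 * lam * y s - (b * sin (2 * lam * s) - a * (1 - cos (2 * lam * s))))]
  have e2 : 2 * lam * y s - (b * sin (2 * lam * s) - a * (1 - cos (2 * lam * s))) = 0 := by
    nlinarith [sq_nonneg (2 * lam * x s - (a * sin (2 * lam * s) + b * (1 - cos (2 * lam * s)))),
      sq_nonneg (2 * lam * y s - (b * sin (2 * lam * s) - a * (1 - cos (2 * lam * s))))]
  constructor
  · rw [eq_div_iff (by positivity)]; linarith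
  · rw [eq_div_iff (by positivity)]; linarith

/-- The geodesic of curvature `λ > 0` with unit horizontal
velocity leaving the south pole `(0, −π/(4λ²))` stays on the Pansu sphere `S_λ`:
on `[0, π/(2λ)]` it lies on the lower graph `t = −f_λ(|z|)`, on
`[π/(2λ), π/λ]` on the upper graph `t = f_λ(|z|)`, and at `s = π/λ` it reaches
the north pole `(0, π/(4λ²))`. -/
theorem geodesic_lies_on_pansu_sphere
    (n : ℕ) (hn : 1 ≤ n) (lam : ℝ) (hlam : 0 < lam)
    (A B : Fin n → ℝ) (hAB : ∑ i, ((A i) ^ 2 + (B i) ^ 2) = 1)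
    (x y : ℝ → Fin n → ℝ) (t : ℝ → ℝ)
    (hx : ContDiff ℝ 2 x) (hy : ContDiff ℝ 2 y) (ht : ContDiff ℝ 2 t)
    (hxeq : ∀ s, ∀ i, deriv (deriv fun u => x u i) s = 2 * lam * deriv (fun u => y u i) s)
    (hyeq : ∀ s, ∀ i, deriv (deriv fun u => y u i) s = -(2 * lam) * deriv (fun u => x u i) s)
    (hteq : ∀ s, deriv t s
        = ∑ i, (deriv (fun u => x u i) s * y s i - x s i * deriv (fun u => y u i) s))
    (hx0 : x 0 = 0) (hy0 : y 0 = 0) (ht0 : t 0 = -(π / (4 * lam ^ 2)))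
    (hdx0 : ∀ i, deriv (fun u => x u i) 0 = A i)
    (hdy0 : ∀ i, deriv (fun u => y u i) 0 = B i) :
    (∀ s ∈ Set.Icc (0 : ℝ) (π / (2 * lam)),
      t s = -pansuProfile lam (Real.sqrt (∑ i, ((x s i) ^ 2 + (y s i) ^ 2)))) ∧
    (∀ s ∈ Set.Icc (π / (2 * lam)) (π / lam),
      t s = pansuProfile lam (Real.sqrt (∑ i, ((x s i) ^ 2 + (y s i) ^ 2)))) ∧
    (∀ s ∈ Set.Icc (0 : ℝ) (π / lam), ((x s, y s, t s) : Hei n) ∈ pansuSphere n lam) ∧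
    x (π / lam) = 0 ∧ y (π / lam) = 0 ∧ t (π / lam) = π / (4 * lam ^ 2) := by
  have key := fun i => pansu_aux_unique lam (A i) (B i) hlam (fun u => x u i) (fun u => y u i)
    (contDiff_pi.1 hx i) (contDiff_pi.1 hy i) (fun s => hxeq s i) (fun s => hyeq s i)
    (by simp [hx0]) (by simp [hy0]) (hdx0 i) (hdy0 i)
  have hl : lam ≠ 0 := hlam.ne'
  have hsum : ∀ s, ∑ i, ((x s i) ^ 2 + (y s i) ^ 2) = (sin (lam * s) / lam) ^ 2 := by
    intro s
    have : ∀ i, (x s i) ^ 2 + (y s i) ^ 2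
        = (A i ^ 2 + B i ^ 2) * (sin (lam * s) / lam) ^ 2 := by
      intro i
      obtain ⟨⟨h1, h2⟩, -⟩ := key i s
      rw [h1, h2]
      have h3 : 2 * lam * s = 2 * (lam * s) := by ring
      rw [h3, sin_two_mul, cos_two_mul, cos_sq']
      have h4 := sin_sq_add_cos_sq (lam * s)
      field_simp
      linear_combination 4 * (A i ^ 2 + B i ^ 2) * sin (lam * s) ^ 2 * h4
    rw [Finset.sum_congr rfl (fun i _ => this i), ← Finset.sum_mul, hAB, one_mul]
  have htd : ∀ s, deriv t s = (1 - cos (2 * lam * s)) / (2 * lam) := by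
    intro s
    have : ∀ i, (deriv (fun u => x u i) s * y s i - x s i * deriv (fun u => y u i) s)
        = (A i ^ 2 + B i ^ 2) * ((1 - cos (2 * lam * s)) / (2 * lam)) := by
      intro i
      obtain ⟨⟨h1, h2⟩, h3, h4⟩ := key i s
      rw [h3, h4, h1, h2]
      have h5 := sin_sq_add_cos_sq (2 * lam * s)
      field_simp
      linear_combination (A i ^ 2 + B i ^ 2) * h5
    rw [hteq, Finset.sum_congr rfl (fun i _ => this i), ← Finset.sum_mul, hAB, one_mul]
  have hT : ∀ s, t s = (1 / (2 * lam ^ 2)) * (lam * s - π / 2 - sin (lam * s) * cos (lam * s)) := by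
    intro s
    have hd : ∀ u, HasDerivAt (fun u => t u - (u / (2 * lam) - sin (2 * lam * u) / (4 * lam ^ 2)))
        0 u := by
      intro u
      have h1 : HasDerivAt t _ u := (ht.differentiable (by norm_num) u).hasDerivAt
      have h2 : HasDerivAt (fun u => sin (2 * lam * u)) (cos (2 * lam * u) * (2 * lam)) u := by
        simpa using ((hasDerivAt_id u).const_mul (2 * lam)).sin
      refine (h1.sub (((hasDerivAt_id u).div_const (2 * lam)).sub
        (h2.div_const (4 * lam ^ 2)))).congr_deriv ?_
      rw [htd]
      field_simp
      ring
    have h := is_const_of_deriv_eq_zero (fun u => (hd u).differentiableAt)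
      (fun u => (hd u).deriv) s 0
    have h3 : 2 * lam * s = 2 * (lam * s) := by ring
    simp only [ht0, mul_zero, sin_zero, zero_div, sub_zero, h3, sin_two_mul] at h
    rw [sub_eq_iff_eq_add] at h
    rw [h]
    field_simp
    ring
  have hsq : ∀ s ∈ Set.Icc (0 : ℝ) (π / lam),
      Real.sqrt (∑ i, ((x s i) ^ 2 + (y s i) ^ 2)) = sin (lam * s) / lam := by
    intro s hs
    rw [hsum]
    apply Real.sqrt_sq
    refine div_nonneg (sin_nonneg_of_nonneg_of_le_pi (mul_nonneg hlam.le hs.1) ?_) hlam.le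
    have := (le_div_iff₀ hlam).1 hs.2
    linarith
  have hpl : π / (2 * lam) ≤ π / lam := by
    gcongr
    linarith
  have hp0 : 0 ≤ π / (2 * lam) := by positivity
  have hprof : ∀ s, pansuProfile lam (sin (lam * s) / lam) = (1 / (2 * lam ^ 2)) *
      (sin (lam * s) * |cos (lam * s)| + arccos (sin (lam * s))) := by
    intro s
    unfold pansuProfile
    have h1 : lam * (sin (lam * s) / lam) = sin (lam * s) := by field_simp
    have h2 : 1 - lam ^ 2 * (sin (lam * s) / lam) ^ 2 = cos (lam * s) ^ 2 := by
      rw [cos_sq']; field_simp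
    rw [h2, h1, Real.sqrt_sq_eq_abs]
  have c1 : ∀ s ∈ Set.Icc (0 : ℝ) (π / (2 * lam)),
      t s = -pansuProfile lam (Real.sqrt (∑ i, ((x s i) ^ 2 + (y s i) ^ 2))) := by
    intro s hs
    have h1 : 0 ≤ lam * s := mul_nonneg hlam.le hs.1
    have h2 : lam * s ≤ π / 2 := by
      have := (le_div_iff₀ (by positivity)).1 hs.2
      linarith
    rw [hsq s ⟨hs.1, hs.2.trans hpl⟩, hprof,
      abs_of_nonneg (cos_nonneg_of_neg_pi_div_two_le_of_le (by linarith [pi_pos]) h2), hT,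
      ← cos_pi_div_two_sub (lam * s), arccos_cos (by linarith) (by linarith [pi_pos])]
    ring
  have c2 : ∀ s ∈ Set.Icc (π / (2 * lam)) (π / lam),
      t s = pansuProfile lam (Real.sqrt (∑ i, ((x s i) ^ 2 + (y s i) ^ 2))) := by
    intro s hs
    have h1 : lam * s ≤ π := by
      have := (le_div_iff₀ hlam).1 hs.2
      linarith
    have h2 : π / 2 ≤ lam * s := by
      have := (div_le_iff₀ (by positivity)).1 hs.1
      linarith
    have h3 : sin (lam * s) = cos (lam * s - π / 2) := (cos_sub_pi_div_two _).symm
    rw [hsq s ⟨hp0.trans hs.1, hs.2⟩, hprof,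
      abs_of_nonpos (cos_nonpos_of_pi_div_two_le_of_le h2 (by linarith [pi_pos])), hT,
      h3, arccos_cos (by linarith) (by linarith [pi_pos])]
    ring
  have hpi : lam * (π / lam) = π := by field_simp
  have h2pi : 2 * lam * (π / lam) = 2 * π := by field_simp
  refine ⟨c1, c2, ?_, ?_, ?_, ?_⟩
  · intro s hs
    refine ⟨?_, ?_⟩
    · change Real.sqrt (∑ i, ((x s i) ^ 2 + (y s i) ^ 2)) ≤ 1 / lam
      rw [hsq s hs]
      gcongr
      exact sin_le_one _
    · rcases le_total s (π / (2 * lam)) with h | h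
      · exact Or.inr (c1 s ⟨hs.1, h⟩)
      · exact Or.inl (c2 s ⟨h, hs.2⟩)
  · funext i
    have := (key i (π / lam)).1.1
    rw [h2pi] at this
    simpa using this
  · funext i
    have := (key i (π / lam)).1.2
    rw [h2pi] at this
    simpa using this
  · rw [hT, hpi, sin_pi]
    field_simp
    ring

end
end

section
/- For every n ≥ 1 and λ > 0, the Pansu ball satisfies the identity (2n+1)·P(B_λ) = 2n(2n+2)·λ·|B_λ|, where P(B_λ) is its horizontal perimeter and |B_λ| its Lebesgue volume. (This expresses that the sphere S_λ = ∂B_λ is critical for the functional Area − 2nλ·Volume under Heisenberg dilations.) -/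
open MeasureTheory Real Filter Set
open scoped BigOperators ENNReal NNReal Topology

noncomputable section

section PartA
variable {Z : Type*} [NormedAddCommGroup Z] [NormedSpace ℝ Z] [FiniteDimensional ℝ Z]
  [MeasurableSpace Z] [BorelSpace Z] (μ : Measure Z) [μ.IsAddHaarMeasure]

lemma integral_fderiv_zero (G : Z → ℝ) (hG : ContDiff ℝ 1 G) (hc : HasCompactSupport G) (v : Z) :
    ∫ z, fderiv ℝ G z v ∂μ = 0 := by
  have hi : Integrable G μ := hG.continuous.integrable_of_hasCompactSupport hc
  have hi' : Integrable (fun z => fderiv ℝ G z v) μ :=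
    ((hG.continuous_fderiv one_ne_zero).clm_apply continuous_const).integrable_of_hasCompactSupport
      (hc.fderiv_apply (𝕜 := ℝ) v)
  have := integral_mul_fderiv_eq_neg_fderiv_mul_of_integrable (μ := μ) (𝕜 := ℝ) (f := fun _ : Z => (1:ℝ))
    (g := G) (v := v) (by simp) (by simpa using hi') (by simpa using hi)
    (fun x _ => by fun_prop) (fun x _ => (hG.differentiable one_ne_zero) x)
  simpa using this

lemma slab_ibp (a : Z × ℝ → ℝ) (ha : ContDiff ℝ 1 a) (φ : Z → ℝ) (hφ : ContDiff ℝ 1 φ)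
    (hc : HasCompactSupport φ) (v : Z) :
    Integrable (fun z => ∫ t in (-φ z)..(φ z), fderiv ℝ a (z, t) (v, 0)) μ ∧
    Integrable (fun z => (a (z, φ z) + a (z, -φ z)) * fderiv ℝ φ z v) μ ∧
    ∫ z, (∫ t in (-φ z)..(φ z), fderiv ℝ a (z, t) (v, 0)) ∂μ
      = - ∫ z, (a (z, φ z) + a (z, -φ z)) * fderiv ℝ φ z v ∂μ := by
  have hφc := hφ.continuous
  have hac := ha.continuous
  have hφ' : Continuous (fun z => fderiv ℝ φ z v) :=
    (hφ.continuous_fderiv one_ne_zero).clm_apply continuous_const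
  have ha' : ∀ w : Z × ℝ, Continuous (fun p => fderiv ℝ a p w) := fun w =>
    (ha.continuous_fderiv one_ne_zero).clm_apply continuous_const
  set D : Z → ℝ → ℝ := fun z τ => fderiv ℝ φ z v * (a (z, τ * φ z) +
      τ * (φ z * fderiv ℝ a (z, τ * φ z) (0, 1))) + φ z * fderiv ℝ a (z, τ * φ z) (v, 0) with hD
  have hDc : Continuous (Function.uncurry D) := by
    have h1 : Continuous (fun p : Z × ℝ => ((p.1, p.2 * φ p.1) : Z × ℝ)) := by fun_prop
    have h2 := (ha' (0,1)).comp h1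
    have h3 := (ha' (v,0)).comp h1
    have h4 := hφ'.comp (continuous_fst (X := Z) (Y := ℝ))
    simp only [Function.comp_def] at h2 h3 h4
    simp only [hD, Function.uncurry_def]
    fun_prop
  have hDs : ∀ z τ, z ∉ tsupport φ → D z τ = 0 := by
    intro z τ hz
    have h1 : φ z = 0 := image_eq_zero_of_notMem_tsupport hz
    have h2 : fderiv ℝ φ z = 0 := by
      by_contra h
      exact hz (support_fderiv_subset ℝ (by simpa using h))
    simp [hD, h1, h2]
  have hDint : Integrable (Function.uncurry D) (μ.prod (volume.restrict (Set.Ioc (-1:ℝ) 1))) := by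
    have hK : IsCompact (tsupport φ ×ˢ Set.Icc (-1:ℝ) 1) := hc.isCompact.prod isCompact_Icc
    have h1 : IntegrableOn (Function.uncurry D) (tsupport φ ×ˢ Set.Icc (-1:ℝ) 1) (μ.prod volume) :=
      hDc.continuousOn.integrableOn_compact hK
    have h2 : IntegrableOn (Function.uncurry D) (Set.univ ×ˢ Set.Icc (-1:ℝ) 1) (μ.prod volume) := by
      refine h1.of_forall_sdiff_eq_zero (MeasurableSet.univ.prod measurableSet_Icc) ?_
      rintro ⟨z, τ⟩ ⟨h, h'⟩
      refine hDs z τ fun hz => h' ⟨hz, h.2⟩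
    have h3 := h2.mono_set (Set.prod_mono_right (s := (Set.univ : Set Z)) (Set.Ioc_subset_Icc_self (a := (-1:ℝ)) (b := 1)))
    unfold IntegrableOn at h3
    rwa [← Measure.prod_restrict, Measure.restrict_univ] at h3
  have hderiv : ∀ τ, ∫ z, D z τ ∂μ = 0 := by
    intro τ
    have hG : ContDiff ℝ 1 (fun z => φ z * a (z, τ * φ z)) := by fun_prop
    rw [← integral_fderiv_zero μ _ hG hc.mul_right v]
    congr 1 with z
    have e1 : HasFDerivAt φ (fderiv ℝ φ z) z := (hφ.differentiable one_ne_zero z).hasFDerivAt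
    have e2 : HasFDerivAt a (fderiv ℝ a (z, τ * φ z)) (z, τ * φ z) :=
      (ha.differentiable one_ne_zero _).hasFDerivAt
    have e3 : HasFDerivAt (fun z => ((z, τ * φ z) : Z × ℝ))
        ((ContinuousLinearMap.id ℝ Z).prod (τ • fderiv ℝ φ z)) z :=
      (hasFDerivAt_id z).prodMk (e1.const_mul τ)
    have e4 := e1.mul (e2.comp z e3)
    have e5 : fderiv ℝ (fun z => φ z * a (z, τ * φ z)) z = _ := e4.fderiv
    rw [e5]
    have e6 : ((v, τ * fderiv ℝ φ z v) : Z × ℝ) = (v, 0) + (τ * fderiv ℝ φ z v) • ((0:Z), (1:ℝ)) := by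
      simp
    simp only [hD, add_apply, smul_apply,
      ContinuousLinearMap.comp_apply, ContinuousLinearMap.prod_apply, smul_eq_mul,
      ContinuousLinearMap.id_apply, Function.comp_def]
    rw [e6, map_add, map_smul, smul_eq_mul]
    ring
  have hsw := integral_integral_swap hDint
  simp only [hderiv, integral_zero] at hsw
  have hInt := hDint.integral_prod_left
  have hinner : ∀ z, ∫ τ in Set.Ioc (-1:ℝ) 1, D z τ =
      (a (z, φ z) + a (z, -φ z)) * fderiv ℝ φ z v +
        ∫ t in (-φ z)..(φ z), fderiv ℝ a (z, t) (v, 0) := by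
    intro z
    rw [← intervalIntegral.integral_of_le (by norm_num)]
    have c1 : Continuous (fun τ : ℝ => ((z, τ * φ z) : Z × ℝ)) := by fun_prop
    have c2 := (ha' (0,1)).comp c1
    have c3 := (ha' (v,0)).comp c1
    simp only [Function.comp_def] at c2 c3
    have c4 : Continuous (fun τ : ℝ => a (z, τ * φ z) +
      τ * (φ z * fderiv ℝ a (z, τ * φ z) (0, 1))) := by fun_prop
    have c5 : Continuous (fun τ : ℝ => fderiv ℝ φ z v * (a (z, τ * φ z) +
      τ * (φ z * fderiv ℝ a (z, τ * φ z) (0, 1)))) := continuous_const.mul c4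
    have c6 : Continuous (fun τ : ℝ => φ z * fderiv ℝ a (z, τ * φ z) (v, 0)) :=
      continuous_const.mul c3
    simp only [hD]
    rw [intervalIntegral.integral_add (c5.intervalIntegrable _ _) (c6.intervalIntegrable _ _), intervalIntegral.integral_const_mul,
      intervalIntegral.integral_const_mul]
    have hF : ∀ τ ∈ Set.uIcc (-1:ℝ) 1, HasDerivAt (fun τ => τ * a (z, τ * φ z)) (a (z, τ * φ z) +
      τ * (φ z * fderiv ℝ a (z, τ * φ z) (0, 1))) τ := by
      intro τ _
      have e2 : HasFDerivAt a (fderiv ℝ a (z, τ * φ z)) (z, τ * φ z) :=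
        (ha.differentiable one_ne_zero _).hasFDerivAt
      have e3 : HasDerivAt (fun τ => ((z, τ * φ z) : Z × ℝ)) ((0, 1 * φ z)) τ :=
        (hasDerivAt_const τ z).prodMk ((hasDerivAt_id τ).mul_const (φ z))
      have e4 := e2.comp_hasDerivAt τ e3
      have e5 := (hasDerivAt_id τ).mul e4
      have e6 : ((0, 1 * φ z) : Z × ℝ) = φ z • ((0:Z), (1:ℝ)) := by simp
      rw [e6, map_smul] at e5
      exact e5.congr_deriv (by simp)
    rw [intervalIntegral.integral_eq_sub_of_hasDerivAt hF (c4.intervalIntegrable _ _),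
      intervalIntegral.mul_integral_comp_mul_right (f := fun t => fderiv ℝ a (z, t) (v, 0))]
    simp
    ring
  have hfst : Integrable (fun z => (a (z, φ z) + a (z, -φ z)) * fderiv ℝ φ z v) μ := by
    refine Continuous.integrable_of_hasCompactSupport (by fun_prop) ?_
    exact (hc.fderiv_apply (𝕜 := ℝ) v).mul_left
  simp only [Function.uncurry_apply_pair, hinner] at hInt
  have hsnd : Integrable (fun z => ∫ t in (-φ z)..(φ z), fderiv ℝ a (z, t) (v, 0)) μ := by
    convert hInt.sub hfst using 1
    ext z; simp
  refine ⟨hsnd, hfst, ?_⟩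
  simp only [hinner] at hsw
  rw [integral_add hfst hsnd] at hsw
  linarith
end PartA

section PartB

def chi (ε s : ℝ) : ℝ := (max s ε - ε) ^ 2 / max s ε
def chi' (ε s : ℝ) : ℝ := 1 - ε ^ 2 / (max s ε) ^ 2

lemma chi_pos_max {ε : ℝ} (hε : 0 < ε) (s : ℝ) : 0 < max s ε := lt_max_of_lt_right hε

lemma chi_eq_zero {ε s : ℝ} (h : s ≤ ε) : chi ε s = 0 := by simp [chi, max_eq_right h]
lemma chi'_eq_zero {ε s : ℝ} (hε : 0 < ε) (h : s ≤ ε) : chi' ε s = 0 := by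
  simp [chi', max_eq_right h, hε.ne']
lemma chi_nonneg {ε : ℝ} (hε : 0 < ε) (s : ℝ) : 0 ≤ chi ε s :=
  div_nonneg (sq_nonneg _) (chi_pos_max hε s).le
lemma chi_le {ε s : ℝ} (hε : 0 < ε) (hs : 0 ≤ s) : chi ε s ≤ s := by
  rcases le_total s ε with h | h
  · rw [chi_eq_zero h]; exact hs
  · rw [chi, max_eq_left h, div_le_iff₀ (by linarith)]
    nlinarith
lemma chi'_nonneg {ε : ℝ} (hε : 0 < ε) (s : ℝ) : 0 ≤ chi' ε s := by
  have := chi_pos_max hε s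
  rw [chi', sub_nonneg, div_le_one (by positivity)]
  exact pow_le_pow_left₀ hε.le (le_max_right _ _) 2
lemma chi'_le_one {ε : ℝ} (s : ℝ) : chi' ε s ≤ 1 := by
  rw [chi']; have : 0 ≤ ε ^ 2 / (max s ε) ^ 2 := by positivity
  linarith
lemma chi'_continuous {ε : ℝ} (hε : 0 < ε) : Continuous (chi' ε) := by
  unfold chi'
  refine continuous_const.sub (continuous_const.div (by fun_prop) fun s => ?_)
  exact (pow_pos (chi_pos_max hε s) 2).ne'
lemma chi_continuous {ε : ℝ} (hε : 0 < ε) : Continuous (chi ε) := by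
  unfold chi
  exact Continuous.div (by fun_prop) (by fun_prop) fun s => (chi_pos_max hε s).ne'
lemma chi_hasDerivAt {ε : ℝ} (hε : 0 < ε) (s : ℝ) : HasDerivAt (chi ε) (chi' ε s) s := by
  refine hasDerivAt_of_hasDerivAt_of_ne' (x := ε) (fun y hy => ?_)
    (chi_continuous hε).continuousAt (chi'_continuous hε).continuousAt s
  rcases lt_or_gt_of_ne hy with h | h
  · rw [chi'_eq_zero hε h.le]
    refine (hasDerivAt_const y (0:ℝ)).congr_of_eventuallyEq ?_
    filter_upwards [Iio_mem_nhds h] with x hx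
    exact chi_eq_zero (le_of_lt hx)
  · have hy0 : 0 < y := hε.trans h
    have h1 : HasDerivAt (fun x : ℝ => (x - ε) ^ 2 / x) (chi' ε y) y := by
      have := (((hasDerivAt_id y).sub_const ε).pow 2).div (hasDerivAt_id y) hy0.ne'
      refine this.congr_deriv ?_
      simp only [chi', max_eq_left h.le, id]
      field_simp
      simp
      ring
    refine h1.congr_of_eventuallyEq ?_
    filter_upwards [Ioi_mem_nhds h] with x hx
    have hx : ε < x := hx
    simp [chi, max_eq_left hx.le]

def ep (k : ℕ) : ℝ := 1 / ((k : ℝ) + 1)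
lemma ep_pos (k : ℕ) : 0 < ep k := by unfold ep; positivity
lemma ep_tendsto : Tendsto ep atTop (𝓝 0) := tendsto_one_div_add_atTop_nhds_zero_nat

lemma chi_tendsto {s : ℝ} (hs : 0 ≤ s) : Tendsto (fun k => chi (ep k) s) atTop (𝓝 s) := by
  rcases hs.eq_or_lt with rfl | hs
  · simp only [chi_eq_zero (ep_pos _).le]; exact tendsto_const_nhds
  · have h1 : Tendsto (fun k => (max s (ep k) - ep k) ^ 2 / max s (ep k)) atTop
        (𝓝 ((max s 0 - 0) ^ 2 / max s 0)) := by
      have hm := (tendsto_const_nhds (x := s)).max ep_tendsto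
      refine ((hm.sub ep_tendsto).pow 2).div hm ?_
      rw [max_eq_left hs.le]; exact hs.ne'
    rw [max_eq_left hs.le] at h1
    have h2 : (s - 0) ^ 2 / s = s := by field_simp; ring
    rw [h2] at h1
    exact h1
lemma chi'_tendsto {s : ℝ} (hs : 0 < s) : Tendsto (fun k => chi' (ep k) s) atTop (𝓝 1) := by
  have h1 : Tendsto (fun k => 1 - (ep k) ^ 2 / (max s (ep k)) ^ 2) atTop
      (𝓝 (1 - 0 ^ 2 / (max s 0) ^ 2)) := by
    have hm := (tendsto_const_nhds (x := s)).max ep_tendsto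
    refine tendsto_const_nhds.sub ((ep_tendsto.pow 2).div (hm.pow 2) ?_)
    rw [max_eq_left hs.le]; exact (pow_pos hs 2).ne'
  simpa [chi'] using h1

structure Prof (R2 : ℝ) (g g' : ℝ → ℝ) : Prop where
  cont : Continuous g
  nonneg : ∀ q, 0 ≤ g q
  zero : ∀ q, R2 ≤ q → g q = 0
  hd : ∀ q, 0 < g q → HasDerivAt g (g' q) q
  hc : ∀ q, 0 < g q → ContinuousAt g' q
  zero' : ∀ q, g q = 0 → g' q = 0

def tr (ε : ℝ) (g : ℝ → ℝ) (q : ℝ) : ℝ := chi ε (g q)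
def tr' (ε : ℝ) (g g' : ℝ → ℝ) (q : ℝ) : ℝ := chi' ε (g q) * g' q

variable {R2 : ℝ} {g g' : ℝ → ℝ}

lemma Prof.tr_hasDerivAt (h : Prof R2 g g') {ε : ℝ} (hε : 0 < ε) (q : ℝ) :
    HasDerivAt (tr ε g) (tr' ε g g' q) q := by
  rcases (h.nonneg q).eq_or_lt with h0 | h0
  · rw [tr', h.zero' q h0.symm, mul_zero]
    refine (hasDerivAt_const q (0:ℝ)).congr_of_eventuallyEq ?_
    have : ∀ᶠ x in 𝓝 q, g x < ε := h.cont.continuousAt.eventually_lt continuousAt_const (by linarith)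
    filter_upwards [this] with x hx
    exact chi_eq_zero hx.le
  · exact (chi_hasDerivAt hε (g q)).comp q (h.hd q h0)

lemma Prof.tr'_cont (h : Prof R2 g g') {ε : ℝ} (hε : 0 < ε) : Continuous (tr' ε g g') := by
  rw [continuous_iff_continuousAt]
  intro q
  rcases (h.nonneg q).eq_or_lt with h0 | h0
  · refine (continuousAt_const (y := (0:ℝ))).congr ?_
    have : ∀ᶠ x in 𝓝 q, g x < ε := h.cont.continuousAt.eventually_lt continuousAt_const (by linarith)
    filter_upwards [this] with x hx
    rw [tr', chi'_eq_zero hε hx.le, zero_mul]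
  · exact ((chi'_continuous hε).comp h.cont).continuousAt.mul (h.hc q h0)

lemma Prof.tr_contDiff (h : Prof R2 g g') {ε : ℝ} (hε : 0 < ε) : ContDiff ℝ 1 (tr ε g) := by
  rw [contDiff_one_iff_deriv]
  refine ⟨fun q => (h.tr_hasDerivAt hε q).differentiableAt, ?_⟩
  have : deriv (tr ε g) = tr' ε g g' := funext fun q => (h.tr_hasDerivAt hε q).deriv
  rw [this]; exact h.tr'_cont hε

lemma Prof.tr_zero (h : Prof R2 g g') {ε : ℝ} (hε : 0 < ε) (q : ℝ) (hq : R2 ≤ q) :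
    tr ε g q = 0 := by rw [tr, h.zero q hq, chi_eq_zero hε.le]

lemma Prof.tr_tendsto (h : Prof R2 g g') (q : ℝ) :
    Tendsto (fun k => tr (ep k) g q) atTop (𝓝 (g q)) := chi_tendsto (h.nonneg q)

lemma Prof.tr'_tendsto (h : Prof R2 g g') (q : ℝ) :
    Tendsto (fun k => tr' (ep k) g g' q) atTop (𝓝 (g' q)) := by
  rcases (h.nonneg q).eq_or_lt with h0 | h0
  · simp [tr', h.zero' q h0.symm]
  · simpa [tr'] using (chi'_tendsto h0).mul_const (g' q)

lemma tr'_abs_le {ε : ℝ} (hε : 0 < ε) (q : ℝ) : |tr' ε g g' q| ≤ |g' q| := by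
  rw [tr', abs_mul, abs_of_nonneg (chi'_nonneg hε _)]
  exact mul_le_of_le_one_left (abs_nonneg _) (chi'_le_one _)

/-! ### radial functions on the horizontal space -/

abbrev Zs (n : ℕ) : Type := (Fin n → ℝ) × (Fin n → ℝ)

def Qf {n : ℕ} (z : Zs n) : ℝ := ∑ i, ((z.1 i) ^ 2 + (z.2 i) ^ 2)

variable {n : ℕ}

lemma Qf_nonneg (z : Zs n) : 0 ≤ Qf z := Finset.sum_nonneg fun i _ => by positivity

instance zs_haar (n : ℕ) : (volume : Measure (Zs n)).IsAddHaarMeasure :=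
  Measure.prod.instIsAddHaarMeasure _ _

@[fun_prop]
lemma Qf_contDiff : ContDiff ℝ 1 (Qf (n := n)) := by unfold Qf; fun_prop

@[fun_prop]
lemma Qf_cont : Continuous (Qf (n := n)) := Qf_contDiff.continuous

lemma Qf_hasFDerivAt (z v : Zs n) : fderiv ℝ Qf z v = ∑ i, (2 * z.1 i * v.1 i + 2 * z.2 i * v.2 i) := by
  have h1 : ∀ i, HasFDerivAt (fun z : Zs n => z.1 i)
      ((ContinuousLinearMap.proj i).comp (ContinuousLinearMap.fst ℝ _ _)) z := fun i =>
    ((ContinuousLinearMap.proj (R := ℝ) (φ := fun _ : Fin n => ℝ) i).comp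
      (ContinuousLinearMap.fst ℝ (Fin n → ℝ) (Fin n → ℝ))).hasFDerivAt
  have h2 : ∀ i, HasFDerivAt (fun z : Zs n => z.2 i)
      ((ContinuousLinearMap.proj i).comp (ContinuousLinearMap.snd ℝ _ _)) z := fun i =>
    ((ContinuousLinearMap.proj (R := ℝ) (φ := fun _ : Fin n => ℝ) i).comp
      (ContinuousLinearMap.snd ℝ (Fin n → ℝ) (Fin n → ℝ))).hasFDerivAt
  have h3 := HasFDerivAt.fun_sum (u := Finset.univ) fun i _ => ((h1 i).pow 2).add ((h2 i).pow 2)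
  have h4 : fderiv ℝ Qf z = _ := h3.fderiv
  rw [h4]
  simp [mul_assoc]

lemma Qf_bounded (R2 : ℝ) : IsCompact {z : Zs n | Qf z ≤ R2} := by
  refine Metric.isCompact_of_isClosed_isBounded (isClosed_le Qf_cont continuous_const) ?_
  refine (Metric.isBounded_closedBall (x := (0 : Zs n)) (r := √R2)).subset ?_
  intro z hz
  have hz : Qf z ≤ R2 := hz
  have key : ∀ i, (z.1 i) ^ 2 + (z.2 i) ^ 2 ≤ R2 := fun i =>
    (Finset.single_le_sum (f := fun i => (z.1 i) ^ 2 + (z.2 i) ^ 2)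
      (fun i _ => by positivity) (Finset.mem_univ i)).trans hz
  rw [mem_closedBall_zero_iff, Prod.norm_def, max_le_iff, pi_norm_le_iff_of_nonneg (sqrt_nonneg _),
    pi_norm_le_iff_of_nonneg (sqrt_nonneg _)]
  refine ⟨fun i => ?_, fun i => ?_⟩
  · exact Real.abs_le_sqrt (by nlinarith [key i, sq_nonneg (z.2 i)])
  · exact Real.abs_le_sqrt (by nlinarith [key i, sq_nonneg (z.1 i)])

lemma comp_Qf_support {Φ : ℝ → ℝ} (h0 : ∀ q, R2 ≤ q → Φ q = 0) :
    HasCompactSupport (fun z : Zs n => Φ (Qf z)) := by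
  refine HasCompactSupport.intro (Qf_bounded (n := n) R2) fun z hz => h0 _ ?_
  simp only [mem_ofPred_eq, not_le] at hz
  exact hz.le

lemma comp_Qf_fderiv {Φ : ℝ → ℝ} {d : ℝ} (z v : Zs n) (hΦ : HasDerivAt Φ d (Qf z)) :
    fderiv ℝ (fun z : Zs n => Φ (Qf z)) z v = d * ∑ i, (2 * z.1 i * v.1 i + 2 * z.2 i * v.2 i) := by
  have h := hΦ.comp_hasFDerivAt z ((Qf_contDiff.differentiable one_ne_zero) z).hasFDerivAt
  have h4 : fderiv ℝ (fun z : Zs n => Φ (Qf z)) z = _ := h.fderiv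
  rw [h4, smul_apply, Qf_hasFDerivAt, smul_eq_mul]

lemma comp_Qf_fderiv_x {Φ : ℝ → ℝ} {d : ℝ} (z : Zs n) (i : Fin n) (hΦ : HasDerivAt Φ d (Qf z)) :
    fderiv ℝ (fun z : Zs n => Φ (Qf z)) z (Pi.single i 1, 0) = d * (2 * z.1 i) := by
  rw [comp_Qf_fderiv z _ hΦ]
  simp [Pi.single_apply]

lemma comp_Qf_fderiv_y {Φ : ℝ → ℝ} {d : ℝ} (z : Zs n) (i : Fin n) (hΦ : HasDerivAt Φ d (Qf z)) :
    fderiv ℝ (fun z : Zs n => Φ (Qf z)) z (0, Pi.single i 1) = d * (2 * z.2 i) := by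
  rw [comp_Qf_fderiv z _ hΦ]
  simp [Pi.single_apply]

lemma radial_div {Φ Φ' : ℝ → ℝ} (hΦ : ContDiff ℝ 1 Φ) (hd : ∀ q, HasDerivAt Φ (Φ' q) q)
    (hc : Continuous Φ') (h0 : ∀ q, R2 ≤ q → Φ q = 0) (h0' : ∀ q, R2 ≤ q → Φ' q = 0) :
    (n : ℝ) * ∫ z : Zs n, Φ (Qf z) = - ∫ z : Zs n, Qf z * Φ' (Qf z) := by
  have hG : ContDiff ℝ 1 (fun z : Zs n => Φ (Qf z)) := hΦ.comp Qf_contDiff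
  have hs := comp_Qf_support (n := n) h0
  have hs' := comp_Qf_support (n := n) h0'
  have hcQ := hc.comp (Qf_cont (n := n))
  simp only [Function.comp_def] at hcQ
  have hi : Integrable (fun z : Zs n => Φ (Qf z)) := hG.continuous.integrable_of_hasCompactSupport hs
  have hx : ∀ i, ∫ z : Zs n, (Φ (Qf z) + 2 * z.1 i ^ 2 * Φ' (Qf z)) = 0 := by
    intro i
    have hG2 : ContDiff ℝ 1 (fun z : Zs n => z.1 i * Φ (Qf z)) := by fun_prop
    rw [← integral_fderiv_zero volume _ hG2 hs.mul_left (Pi.single i 1, 0)]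
    congr 1 with z
    have h1 : HasFDerivAt (fun z : Zs n => z.1 i)
      ((ContinuousLinearMap.proj i).comp (ContinuousLinearMap.fst ℝ _ _)) z :=
      ((ContinuousLinearMap.proj (R := ℝ) (φ := fun _ : Fin n => ℝ) i).comp
      (ContinuousLinearMap.fst ℝ (Fin n → ℝ) (Fin n → ℝ))).hasFDerivAt
    have h2 := h1.mul ((hG.differentiable one_ne_zero) z).hasFDerivAt
    have h3 : fderiv ℝ (fun z : Zs n => z.1 i * Φ (Qf z)) z = _ := h2.fderiv
    rw [h3, add_apply, smul_apply, smul_apply, comp_Qf_fderiv_x z i (hd _)]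
    simp; ring
  have hy : ∀ i, ∫ z : Zs n, (Φ (Qf z) + 2 * z.2 i ^ 2 * Φ' (Qf z)) = 0 := by
    intro i
    have hG2 : ContDiff ℝ 1 (fun z : Zs n => z.2 i * Φ (Qf z)) := by fun_prop
    rw [← integral_fderiv_zero volume _ hG2 hs.mul_left (0, Pi.single i 1)]
    congr 1 with z
    have h1 : HasFDerivAt (fun z : Zs n => z.2 i)
      ((ContinuousLinearMap.proj i).comp (ContinuousLinearMap.snd ℝ _ _)) z :=
      ((ContinuousLinearMap.proj (R := ℝ) (φ := fun _ : Fin n => ℝ) i).comp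
      (ContinuousLinearMap.snd ℝ (Fin n → ℝ) (Fin n → ℝ))).hasFDerivAt
    have h2 := h1.mul ((hG.differentiable one_ne_zero) z).hasFDerivAt
    have h3 : fderiv ℝ (fun z : Zs n => z.2 i * Φ (Qf z)) z = _ := h2.fderiv
    rw [h3, add_apply, smul_apply, smul_apply, comp_Qf_fderiv_y z i (hd _)]
    simp; ring
  have hix : ∀ i, Integrable (fun z : Zs n => Φ (Qf z) + 2 * z.1 i ^ 2 * Φ' (Qf z)) := fun i =>
    hi.add (Continuous.integrable_of_hasCompactSupport (by fun_prop) hs'.mul_left)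
  have hiy : ∀ i, Integrable (fun z : Zs n => Φ (Qf z) + 2 * z.2 i ^ 2 * Φ' (Qf z)) := fun i =>
    hi.add (Continuous.integrable_of_hasCompactSupport (by fun_prop) hs'.mul_left)
  have hq : Integrable (fun z : Zs n => Qf z * Φ' (Qf z)) :=
    Continuous.integrable_of_hasCompactSupport (Qf_cont.mul hcQ) hs'.mul_left
  have hsum : ∫ z : Zs n, ∑ i, ((Φ (Qf z) + 2 * z.1 i ^ 2 * Φ' (Qf z)) +
      (Φ (Qf z) + 2 * z.2 i ^ 2 * Φ' (Qf z))) = 0 := by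
    have hixy : ∀ i ∈ Finset.univ, Integrable (fun z : Zs n => (Φ (Qf z) + 2 * z.1 i ^ 2 * Φ' (Qf z)) +
      (Φ (Qf z) + 2 * z.2 i ^ 2 * Φ' (Qf z))) := fun i _ => (hix i).add (hiy i)
    rw [integral_finsetSum _ hixy]
    refine Finset.sum_eq_zero fun i _ => ?_
    rw [integral_add (hix i) (hiy i), hx, hy, add_zero]
  have hre : ∀ z : Zs n, ∑ i, ((Φ (Qf z) + 2 * z.1 i ^ 2 * Φ' (Qf z)) +
      (Φ (Qf z) + 2 * z.2 i ^ 2 * Φ' (Qf z))) = 2 * (n * Φ (Qf z) + Qf z * Φ' (Qf z)) := by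
    intro z
    have : ∀ i, ((Φ (Qf z) + 2 * z.1 i ^ 2 * Φ' (Qf z)) +
      (Φ (Qf z) + 2 * z.2 i ^ 2 * Φ' (Qf z))) = 2 * Φ (Qf z) +
        (z.1 i ^ 2 + z.2 i ^ 2) * (2 * Φ' (Qf z)) := fun i => by ring
    simp only [this]
    have hQ : Qf z = ∑ i, ((z.1 i) ^ 2 + (z.2 i) ^ 2) := rfl
    rw [Finset.sum_add_distrib, ← Finset.sum_mul (f := fun i => z.1 i ^ 2 + z.2 i ^ 2),
      Finset.sum_const, ← hQ]
    simp; ring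
  simp only [hre] at hsum
  rw [integral_const_mul, integral_add (hi.const_mul _) hq, integral_const_mul] at hsum
  linarith

lemma Prof.integrable (h : Prof R2 g g') : Integrable (fun z : Zs n => g (Qf z)) :=
  (h.cont.comp Qf_cont).integrable_of_hasCompactSupport (comp_Qf_support h.zero)

lemma Prof.measurable' (h : Prof R2 g g') : Measurable g' :=
  measurable_of_tendsto_metrizable (fun k => (h.tr'_cont (ep_pos k)).measurable)
    (tendsto_pi_nhds.2 h.tr'_tendsto)

lemma Prof.tr'_zero (h : Prof R2 g g') (ε q : ℝ) (hq : R2 ≤ q) : tr' ε g g' q = 0 := by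
  rw [tr', h.zero' q (h.zero q hq), mul_zero]

lemma Prof.radial_tr (h : Prof R2 g g') (k : ℕ) :
    (n : ℝ) * ∫ z : Zs n, tr (ep k) g (Qf z) = - ∫ z : Zs n, Qf z * tr' (ep k) g g' (Qf z) :=
  radial_div (h.tr_contDiff (ep_pos k)) (h.tr_hasDerivAt (ep_pos k)) (h.tr'_cont (ep_pos k))
    (h.tr_zero (ep_pos k)) (h.tr'_zero (ep k))

lemma Prof.radial (h : Prof R2 g g') (hi : Integrable (fun z : Zs n => Qf z * g' (Qf z))) :
    (n : ℝ) * ∫ z : Zs n, g (Qf z) = - ∫ z : Zs n, Qf z * g' (Qf z) := by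
  have h1 : Tendsto (fun k => ∫ z : Zs n, tr (ep k) g (Qf z)) atTop (𝓝 (∫ z : Zs n, g (Qf z))) := by
    refine tendsto_integral_of_dominated_convergence (fun z => g (Qf z)) (fun k => ?_) h.integrable
      (fun k => ae_of_all _ fun z => ?_) (ae_of_all _ fun z => h.tr_tendsto _)
    · exact ((h.tr_contDiff (ep_pos k)).continuous.comp Qf_cont).aestronglyMeasurable
    · rw [Real.norm_eq_abs, tr, abs_of_nonneg (chi_nonneg (ep_pos k) _)]
      exact chi_le (ep_pos k) (h.nonneg _)
  have h2 : Tendsto (fun k => ∫ z : Zs n, Qf z * tr' (ep k) g g' (Qf z)) atTop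
      (𝓝 (∫ z : Zs n, Qf z * g' (Qf z))) := by
    refine tendsto_integral_of_dominated_convergence (fun z => ‖Qf z * g' (Qf z)‖) (fun k => ?_)
      hi.norm
      (fun k => ae_of_all _ fun z => ?_) (ae_of_all _ fun z => (h.tr'_tendsto _).const_mul _)
    · exact (Qf_cont.mul ((h.tr'_cont (ep_pos k)).comp Qf_cont)).aestronglyMeasurable
    · rw [norm_mul, norm_mul]
      exact mul_le_mul_of_nonneg_left (tr'_abs_le (ep_pos k) _) (norm_nonneg _)
  have h3 := h1.const_mul (n : ℝ)
  simp only [h.radial_tr] at h3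
  exact tendsto_nhds_unique h3 h2.neg

lemma Prof.integrable' (h : Prof R2 g g') (hn : ∀ q, g' q ≤ 0) :
    Integrable (fun z : Zs n => Qf z * g' (Qf z)) := by
  have hm : Measurable (fun z : Zs n => Qf z * g' (Qf z)) :=
    Qf_cont.measurable.mul (h.measurable'.comp Qf_cont.measurable)
  refine ⟨hm.aestronglyMeasurable, ?_⟩
  have hneg : ∀ k q, tr' (ep k) g g' q ≤ 0 := fun k q =>
    mul_nonpos_of_nonneg_of_nonpos (chi'_nonneg (ep_pos k) _) (hn q)
  have hik : ∀ k, Integrable (fun z : Zs n => Qf z * tr' (ep k) g g' (Qf z)) := fun k =>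
    (Qf_cont.mul ((h.tr'_cont (ep_pos k)).comp Qf_cont)).integrable_of_hasCompactSupport
      (comp_Qf_support (h.tr'_zero (ep k))).mul_left
  have hb : ∀ k, ∫⁻ z : Zs n, ‖Qf z * tr' (ep k) g g' (Qf z)‖ₑ ≤
      ENNReal.ofReal (n * ∫ z : Zs n, g (Qf z)) := by
    intro k
    rw [← ofReal_integral_norm_eq_lintegral_enorm (hik k)]
    refine ENNReal.ofReal_le_ofReal ?_
    have e : ∀ z : Zs n, ‖Qf z * tr' (ep k) g g' (Qf z)‖ = -(Qf z * tr' (ep k) g g' (Qf z)) :=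
      fun z => by
        rw [Real.norm_eq_abs, abs_of_nonpos]
        exact mul_nonpos_of_nonneg_of_nonpos (Qf_nonneg z) (hneg k _)
    simp only [e]
    rw [integral_neg, ← h.radial_tr]
    refine mul_le_mul_of_nonneg_left ?_ (Nat.cast_nonneg n)
    refine integral_mono_of_nonneg (ae_of_all _ fun z => chi_nonneg (ep_pos k) _) h.integrable
      (ae_of_all _ fun z => chi_le (ep_pos k) (h.nonneg _))
  have hlim : ∀ z : Zs n, Tendsto (fun k => ‖Qf z * tr' (ep k) g g' (Qf z)‖ₑ) atTop
      (𝓝 ‖Qf z * g' (Qf z)‖ₑ) := fun z => ((h.tr'_tendsto _).const_mul _).enorm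
  have hF : ∫⁻ z : Zs n, ‖Qf z * g' (Qf z)‖ₑ ≤
      liminf (fun k => ∫⁻ z : Zs n, ‖Qf z * tr' (ep k) g g' (Qf z)‖ₑ) atTop := by
    calc _ = ∫⁻ z : Zs n, liminf (fun k => ‖Qf z * tr' (ep k) g g' (Qf z)‖ₑ) atTop :=
          lintegral_congr fun z => (hlim z).liminf_eq.symm
      _ ≤ _ := lintegral_liminf_le fun k =>
        ((Qf_cont.mul ((h.tr'_cont (ep_pos k)).comp Qf_cont)).measurable).enorm
  refine lt_of_le_of_lt (hF.trans ?_) (ENNReal.ofReal_lt_top (r := n * ∫ z : Zs n, g (Qf z)))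
  exact liminf_le_of_le (by isBoundedDefault) fun b hb' => by
    obtain ⟨k, hk⟩ := hb'.exists
    exact hk.trans (hb k)

end PartB

section PartC

def Ff (lam q : ℝ) : ℝ := pansuProfile lam (√q)
def Ff' (lam q : ℝ) : ℝ := -lam * √q / (2 * √(1 - lam ^ 2 * q))
def uf (lam q : ℝ) : ℝ := √q * √(1 - lam ^ 2 * q)
def uf' (lam q : ℝ) : ℝ := √(1 - lam ^ 2 * q) / (2 * √q) - lam ^ 2 * √q / (2 * √(1 - lam ^ 2 * q))
def mf (lam q : ℝ) : ℝ := √q / √(1 - lam ^ 2 * q)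

variable {lam : ℝ}

lemma one_sub_pos (hl : 0 < lam) {q : ℝ} (hq : q < 1 / lam ^ 2) : 0 < 1 - lam ^ 2 * q := by
  rw [lt_div_iff₀ (by positivity)] at hq
  linarith

lemma one_sub_nonpos (hl : 0 < lam) {q : ℝ} (hq : 1 / lam ^ 2 ≤ q) : 1 - lam ^ 2 * q ≤ 0 := by
  rw [div_le_iff₀ (by positivity)] at hq
  linarith

lemma lam_sqrt_lt (hl : 0 < lam) {q : ℝ} (hq : q < 1 / lam ^ 2) : lam * √q < 1 := by
  have h := one_sub_pos hl hq
  rcases le_or_gt q 0 with h0 | h0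
  · rw [sqrt_eq_zero_of_nonpos h0]; simp
  · have h1 := sq_sqrt h0.le
    have h2 := sqrt_nonneg q
    nlinarith [mul_nonneg hl.le h2]

lemma lam_sqrt_ge (hl : 0 < lam) {q : ℝ} (hq : 1 / lam ^ 2 ≤ q) : 1 ≤ lam * √q := by
  have h := one_sub_nonpos hl hq
  have h0 : 0 ≤ q := le_trans (by positivity) hq
  have h1 := sq_sqrt h0
  have h2 := sqrt_nonneg q
  nlinarith [mul_nonneg hl.le h2]

lemma Ff_cont : Continuous (Ff lam) := by
  unfold Ff pansuProfile
  exact continuous_const.mul (Continuous.add (by fun_prop) (Real.continuous_arccos.comp (by fun_prop)))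

lemma Ff_nonneg (hl : 0 < lam) (q : ℝ) : 0 ≤ Ff lam q := by
  unfold Ff pansuProfile
  have := Real.arccos_nonneg (lam * √q)
  positivity

lemma Ff_zero (hl : 0 < lam) (q : ℝ) (hq : 1 / lam ^ 2 ≤ q) : Ff lam q = 0 := by
  have h0 : 0 ≤ q := le_trans (by positivity) hq
  unfold Ff pansuProfile
  rw [sq_sqrt h0, sqrt_eq_zero_of_nonpos (one_sub_nonpos hl hq),
    Real.arccos_of_one_le (lam_sqrt_ge hl hq)]
  simp

lemma Ff_pos (hl : 0 < lam) (q : ℝ) (hq : q < 1 / lam ^ 2) : 0 < Ff lam q := by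
  unfold Ff pansuProfile
  have : 0 < Real.arccos (lam * √q) := Real.arccos_pos.2 (lam_sqrt_lt hl hq)
  positivity

lemma Ff'_contAt (hl : 0 < lam) {q : ℝ} (hq : q < 1 / lam ^ 2) : ContinuousAt (Ff' lam) q := by
  unfold Ff'
  refine ContinuousAt.div (by fun_prop) (by fun_prop) ?_
  have := sqrt_pos.2 (one_sub_pos hl hq)
  positivity

lemma Ff_hd_pos (hl : 0 < lam) {q : ℝ} (h0 : 0 < q) (hq : q < 1 / lam ^ 2) :
    HasDerivAt (Ff lam) (Ff' lam q) q := by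
  have hw2 := one_sub_pos hl hq
  have hw := sqrt_pos.2 hw2
  have hs := sqrt_pos.2 h0
  have hs2 := sq_sqrt h0.le
  have hww := sq_sqrt hw2.le
  have e1 : HasDerivAt (fun q => √q) (1 / (2 * √q)) q := (hasDerivAt_id q).sqrt h0.ne'
  have e2 : HasDerivAt (fun q => √(1 - lam ^ 2 * q)) (-(lam ^ 2 * 1) / (2 * √(1 - lam ^ 2 * q))) q :=
    (((hasDerivAt_id q).const_mul (lam ^ 2)).const_sub 1).sqrt hw2.ne'
  have e3 : HasDerivAt (fun q => lam * √q) (lam * (1 / (2 * √q))) q := e1.const_mul lam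
  have hlt := lam_sqrt_lt hl hq
  have e4 := (Real.hasDerivAt_arccos (x := lam * √q) (by nlinarith [mul_pos hl hs]) hlt.ne).comp q e3
  have e5 := ((e3.mul e2).add e4).const_mul (1 / (2 * lam ^ 2))
  have e6 := e5.congr_of_eventuallyEq (f₁ := Ff lam) (by
    filter_upwards [Ioi_mem_nhds h0] with x hx
    have hx : 0 < x := hx
    simp [Ff, pansuProfile, sq_sqrt hx.le])
  refine e6.congr_deriv ?_
  have e7 : 1 - (lam * √q) ^ 2 = 1 - lam ^ 2 * q := by rw [mul_pow, hs2]
  rw [e7, Ff']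
  set w := √(1 - lam ^ 2 * q)
  set s := √q
  have : w ^ 2 = 1 - lam ^ 2 * s ^ 2 := by rw [hww, hs2]
  field_simp
  linear_combination this

lemma Ff_hd (hl : 0 < lam) {q : ℝ} (hq : q < 1 / lam ^ 2) :
    HasDerivAt (Ff lam) (Ff' lam q) q := by
  rcases lt_trichotomy q 0 with h0 | h0 | h0
  · have e : Ff' lam q = 0 := by simp [Ff', sqrt_eq_zero_of_nonpos h0.le]
    rw [e]
    refine (hasDerivAt_const q (Ff lam 0)).congr_of_eventuallyEq ?_
    filter_upwards [Iio_mem_nhds h0] with x hx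
    have hx : x < 0 := hx
    simp [Ff, sqrt_eq_zero_of_nonpos hx.le]
  · subst h0
    have hR : 0 < 1 / lam ^ 2 := hq
    have A : HasDerivWithinAt (Ff lam) (Ff' lam 0) (Ici 0) 0 := by
      refine hasDerivWithinAt_Ici_of_tendsto_deriv (s := Ioo 0 (1 / lam ^ 2))
        (fun x hx => (Ff_hd_pos hl hx.1 hx.2).differentiableAt.differentiableWithinAt)
        Ff_cont.continuousWithinAt (Ioo_mem_nhdsGT hR) ?_
      refine ((Ff'_contAt hl hq).tendsto.mono_left nhdsWithin_le_nhds).congr' ?_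
      filter_upwards [Ioo_mem_nhdsGT hR] with x hx
      exact (Ff_hd_pos hl hx.1 hx.2).deriv.symm
    have B : HasDerivWithinAt (Ff lam) (Ff' lam 0) (Iic 0) 0 := by
      have e : Ff' lam 0 = 0 := by simp [Ff']
      rw [e]
      refine (hasDerivWithinAt_const 0 _ (Ff lam 0)).congr ?_ rfl
      intro x hx
      have hx : x ≤ 0 := hx
      simp [Ff, sqrt_eq_zero_of_nonpos hx]
    have := B.union A
    rw [Iic_union_Ici] at this
    exact hasDerivWithinAt_univ.1 this
  · exact Ff_hd_pos hl h0 hq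

lemma prof_F (hl : 0 < lam) : Prof (1 / lam ^ 2) (Ff lam) (Ff' lam) where
  cont := Ff_cont
  nonneg := Ff_nonneg hl
  zero := Ff_zero hl
  hd q hq := Ff_hd hl (by
    by_contra h; rw [Ff_zero hl q (not_lt.1 h)] at hq; exact lt_irrefl _ hq)
  hc q hq := Ff'_contAt hl (by
    by_contra h; rw [Ff_zero hl q (not_lt.1 h)] at hq; exact lt_irrefl _ hq)
  zero' q hq := by
    have : 1 / lam ^ 2 ≤ q := by
      by_contra h; exact (Ff_pos hl q (not_le.1 h)).ne' hq
    simp [Ff', sqrt_eq_zero_of_nonpos (one_sub_nonpos hl this)]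

lemma uf_pos {q : ℝ} (h : 0 < uf lam q) : 0 < q ∧ 0 < 1 - lam ^ 2 * q := by
  constructor
  · by_contra h'; simp [uf, sqrt_eq_zero_of_nonpos (not_lt.1 h')] at h
  · by_contra h'; simp [uf, sqrt_eq_zero_of_nonpos (not_lt.1 h')] at h

lemma prof_u (hl : 0 < lam) : Prof (1 / lam ^ 2) (uf lam) (uf' lam) where
  cont := by unfold uf; fun_prop
  nonneg q := by unfold uf; positivity
  zero q hq := by simp [uf, sqrt_eq_zero_of_nonpos (one_sub_nonpos hl hq)]
  hd q hq := by
    obtain ⟨h0, hw2⟩ := uf_pos hq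
    have e1 : HasDerivAt (fun q => √q) (1 / (2 * √q)) q := (hasDerivAt_id q).sqrt h0.ne'
    have e2 : HasDerivAt (fun q => √(1 - lam ^ 2 * q)) (-(lam ^ 2 * 1) / (2 * √(1 - lam ^ 2 * q))) q :=
      (((hasDerivAt_id q).const_mul (lam ^ 2)).const_sub 1).sqrt hw2.ne'
    refine (e1.mul e2).congr_deriv ?_
    unfold uf'
    ring
  hc q hq := by
    obtain ⟨h0, hw2⟩ := uf_pos hq
    have := sqrt_pos.2 h0
    have := sqrt_pos.2 hw2
    unfold uf'
    refine ContinuousAt.sub (ContinuousAt.div (by fun_prop) (by fun_prop) (by positivity))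
      (ContinuousAt.div (by fun_prop) (by fun_prop) (by positivity))
  zero' q hq := by
    rcases mul_eq_zero.1 hq with h | h <;> simp [uf', h]

lemma F'_eq (q : ℝ) : q * Ff' lam q = -(lam / 2) * (q * mf lam q) := by
  unfold Ff' mf; ring

lemma m_eq (hl : 0 < lam) {q : ℝ} (hq : 0 ≤ q) : mf lam q = uf lam q + lam ^ 2 * (q * mf lam q) := by
  unfold mf uf
  rcases le_or_gt (1 - lam ^ 2 * q) 0 with h | h
  · simp [sqrt_eq_zero_of_nonpos h]
  · have hw := sqrt_pos.2 h
    have hww := sq_sqrt h.le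
    field_simp
    linear_combination -(√q) * hww

lemma u'_eq (hl : 0 < lam) {q : ℝ} (hq : 0 ≤ q) :
    q * uf' lam q = (1 / 2) * uf lam q - lam ^ 2 / 2 * (q * mf lam q) := by
  unfold mf uf uf'
  rcases hq.eq_or_lt with rfl | hq
  · simp
  have hs := sqrt_pos.2 hq
  have hss := sq_sqrt hq.le
  have : ∀ w : ℝ, q * (w / (2 * √q)) = (1 / 2) * (√q * w) := by
    intro w
    field_simp
    linear_combination -w * hss
  rw [mul_sub, this]
  ring

variable {n : ℕ}

lemma qm_integrable (hl : 0 < lam) : Integrable (fun z : Zs n => Qf z * mf lam (Qf z)) := by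
  have h := (prof_F hl).integrable' (n := n) (fun q => by
    unfold Ff'
    rw [neg_mul, neg_div]
    have : 0 ≤ lam * √q / (2 * √(1 - lam ^ 2 * q)) := by positivity
    linarith)
  simp only [F'_eq] at h
  have h2 := h.const_mul (-(2 / lam))
  refine h2.congr (ae_of_all _ fun z => ?_)
  field_simp

lemma m_integrable (hl : 0 < lam) : Integrable (fun z : Zs n => mf lam (Qf z)) := by
  have := ((prof_u hl).integrable (n := n)).add ((qm_integrable (n := n) hl).const_mul (lam ^ 2))
  refine this.congr (ae_of_all _ fun z => ?_)
  exact (m_eq hl (Qf_nonneg z)).symm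

/-- the identity between area and volume integrals -/
lemma area_volume (hl : 0 < lam) :
    (2 * n + 1) * ∫ z : Zs n, mf lam (Qf z) = (2 * n) * (2 * n + 2) * lam * ∫ z : Zs n, Ff lam (Qf z) := by
  have hqm := qm_integrable (n := n) hl
  have hu := (prof_u hl).integrable (n := n)
  have h1 := (prof_F hl).radial (n := n) (by
    simp only [F'_eq]; exact hqm.const_mul _)
  simp only [F'_eq] at h1
  rw [integral_const_mul] at h1
  have e : ∀ z : Zs n, Qf z * uf' lam (Qf z) =
      (1 / 2) * uf lam (Qf z) - lam ^ 2 / 2 * (Qf z * mf lam (Qf z)) := fun z => u'_eq hl (Qf_nonneg z)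
  have h2 := (prof_u hl).radial (n := n) (by
    simp only [e]; exact (hu.const_mul _).sub (hqm.const_mul _))
  simp only [e] at h2
  rw [integral_sub (hu.const_mul _) (hqm.const_mul _), integral_const_mul, integral_const_mul] at h2
  have h3 : ∫ z : Zs n, mf lam (Qf z) = (∫ z : Zs n, uf lam (Qf z)) +
      lam ^ 2 * ∫ z : Zs n, Qf z * mf lam (Qf z) := by
    rw [← integral_const_mul, ← integral_add hu (hqm.const_mul _)]
    exact integral_congr_ae (ae_of_all _ fun z => m_eq hl (Qf_nonneg z))
  rw [h3]
  linear_combination 2 * h2 - (2 * (2 * n + 2) * lam) * h1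

end PartC

section PartD

variable {n : ℕ} {lam : ℝ}

def asm (z : Zs n) (t : ℝ) : Hei n := (z.1, z.2, t)

@[fun_prop]
lemma asm_cont {X : Type*} [TopologicalSpace X] {f : X → Zs n} {g : X → ℝ} (hf : Continuous f)
    (hg : Continuous g) : Continuous (fun x => asm (f x) (g x)) := by
  unfold asm; fun_prop

def asmL (n : ℕ) : Zs n × ℝ →L[ℝ] Hei n :=
  ((ContinuousLinearMap.fst ℝ (Fin n → ℝ) (Fin n → ℝ)).comp (ContinuousLinearMap.fst ℝ (Zs n) ℝ)).prod
    (((ContinuousLinearMap.snd ℝ (Fin n → ℝ) (Fin n → ℝ)).comp (ContinuousLinearMap.fst ℝ (Zs n) ℝ)).prod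
      (ContinuousLinearMap.snd ℝ (Zs n) ℝ))

lemma asmL_apply (p : Zs n × ℝ) : asmL n p = asm p.1 p.2 := rfl

lemma asm_fderiv {c : Hei n → ℝ} (hc : ContDiff ℝ 1 c) (z : Zs n) (t : ℝ) (v : Zs n × ℝ) :
    fderiv ℝ (fun p : Zs n × ℝ => c (asm p.1 p.2)) (z, t) v = fderiv ℝ c (asm z t) (asm v.1 v.2) := by
  have h1 : HasFDerivAt c (fderiv ℝ c (asmL n (z, t))) (asmL n (z, t)) :=
    (hc.differentiable one_ne_zero _).hasFDerivAt
  have h2 := h1.comp (z, t) (asmL n).hasFDerivAt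
  have h3 : fderiv ℝ (fun p : Zs n × ℝ => c (asm p.1 p.2)) (z, t) = _ := h2.fderiv
  rw [h3]
  rfl

lemma asm_contDiff {c : Hei n → ℝ} (hc : ContDiff ℝ 1 c) :
    ContDiff ℝ 1 (fun p : Zs n × ℝ => c (asm p.1 p.2)) := hc.comp (asmL n).contDiff

/-- boundary integrand -/
def bd (a b : Hei n → Fin n → ℝ) (z : Zs n) (φ d : ℝ) : ℝ :=
  ∑ i, ((a (asm z φ) i * (z.2 i - 2 * d * z.1 i) + b (asm z φ) i * (-z.1 i - 2 * d * z.2 i)) +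
    (a (asm z (-φ)) i * (-z.2 i - 2 * d * z.1 i) + b (asm z (-φ)) i * (z.1 i - 2 * d * z.2 i)))

lemma fderiv_apply_cont {c : Hei n → ℝ} (hc : ContDiff ℝ 1 c) (v : Hei n) :
    Continuous (fun p => fderiv ℝ c p v) :=
  (hc.continuous_fderiv one_ne_zero).clm_apply continuous_const

lemma hDiv_cont {a b : Hei n → Fin n → ℝ} (ha : ContDiff ℝ 1 a) (hb : ContDiff ℝ 1 b) :
    Continuous (hDivergence a b) := by
  have ha' : ∀ i v, Continuous (fun p => fderiv ℝ (fun q => a q i) p v) := fun i v =>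
    fderiv_apply_cont (contDiff_pi.1 ha i) v
  have hb' : ∀ i v, Continuous (fun p => fderiv ℝ (fun q => b q i) p v) := fun i v =>
    fderiv_apply_cont (contDiff_pi.1 hb i) v
  unfold hDivergence Xder Yder
  fun_prop

lemma slab_div {R2 : ℝ} {a b : Hei n → Fin n → ℝ} (ha : ContDiff ℝ 1 a) (hb : ContDiff ℝ 1 b)
    {Φ Φ' : ℝ → ℝ} (hΦ : ContDiff ℝ 1 Φ) (hd : ∀ q, HasDerivAt Φ (Φ' q) q)
    (h0 : ∀ q, R2 ≤ q → Φ q = 0) :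
    ∫ z : Zs n, (∫ t in (-Φ (Qf z))..(Φ (Qf z)), hDivergence a b (asm z t)) =
      ∫ z : Zs n, bd a b z (Φ (Qf z)) (Φ' (Qf z)) := by
  have hai := fun i => contDiff_pi.1 ha i
  have hbi := fun i => contDiff_pi.1 hb i
  have hG : ContDiff ℝ 1 (fun z : Zs n => Φ (Qf z)) := hΦ.comp Qf_contDiff
  have hs := comp_Qf_support (n := n) h0
  have hGc := hG.continuous
  have hX := fun i => slab_ibp (volume : Measure (Zs n)) _ (asm_contDiff (hai i)) _ hG hs (Pi.single i 1, 0)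
  have hY := fun i => slab_ibp (volume : Measure (Zs n)) _ (asm_contDiff (hbi i)) _ hG hs (0, Pi.single i 1)
  simp only [asm_fderiv (hai _), asm_fderiv (hbi _), comp_Qf_fderiv_x _ _ (hd _),
    comp_Qf_fderiv_y _ _ (hd _)] at hX hY
  have hac := ha.continuous
  have hbc := hb.continuous
  -- vertical terms
  have hvert : ∀ (c : Hei n → ℝ), ContDiff ℝ 1 c → ∀ (z : Zs n) (s : ℝ),
      ∫ t in (-s)..s, fderiv ℝ c (asm z t) (0, 0, 1) = c (asm z s) - c (asm z (-s)) := by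
    intro c hc z s
    have hcc := (fderiv_apply_cont hc (0, 0, 1)).comp (asm_cont (continuous_const (y := z)) continuous_id)
    refine intervalIntegral.integral_eq_sub_of_hasDerivAt (f := fun t => c (asm z t)) (fun t _ => ?_)
      (hcc.intervalIntegrable _ _)
    have e1 : HasFDerivAt c (fderiv ℝ c (asm z t)) (asm z t) :=
      (hc.differentiable one_ne_zero _).hasFDerivAt
    have e2 : HasDerivAt (fun t => asm z t) ((0, 0, 1) : Hei n) t :=
      (hasDerivAt_const t z.1).prodMk ((hasDerivAt_const t z.2).prodMk (hasDerivAt_id t))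
    exact e1.comp_hasDerivAt t e2
  have hinner : ∀ z : Zs n, ∫ t in (-Φ (Qf z))..(Φ (Qf z)), hDivergence a b (asm z t) =
      ∑ i, (((∫ t in (-Φ (Qf z))..(Φ (Qf z)), fderiv ℝ (fun q => a q i) (asm z t) (asm (Pi.single i 1, 0) 0)) +
        z.2 i * (a (asm z (Φ (Qf z))) i - a (asm z (-Φ (Qf z))) i)) +
        ((∫ t in (-Φ (Qf z))..(Φ (Qf z)), fderiv ℝ (fun q => b q i) (asm z t) (asm (0, Pi.single i 1) 0)) -
        z.1 i * (b (asm z (Φ (Qf z))) i - b (asm z (-Φ (Qf z))) i))) := by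
    intro z
    have ii : ∀ (c : Hei n → ℝ), ContDiff ℝ 1 c → ∀ v, IntervalIntegrable
        (fun t => fderiv ℝ c (asm z t) v) volume (-Φ (Qf z)) (Φ (Qf z)) := fun c hc v =>
      ((fderiv_apply_cont hc v).comp (asm_cont (continuous_const (y := z)) continuous_id)).intervalIntegrable _ _
    simp only [← hvert _ (hai _), ← hvert _ (hbi _)]
    simp only [hDivergence, Xder, Yder]
    have i1 := fun i => (ii _ (hai i) (Pi.single i 1, 0, 0))
    have i2 := fun i => ((ii _ (hai i) (0, 0, 1)).const_mul (z.2 i))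
    have i3 := fun i => (ii _ (hbi i) (0, Pi.single i 1, 0))
    have i4 := fun i => ((ii _ (hbi i) (0, 0, 1)).const_mul (z.1 i))
    refine (intervalIntegral.integral_finsetSum (fun i _ => ((i1 i).add (i2 i)).add ((i3 i).sub (i4 i)))).trans ?_
    refine Finset.sum_congr rfl fun i _ => ?_
    refine (intervalIntegral.integral_add ((i1 i).add (i2 i)) ((i3 i).sub (i4 i))).trans ?_
    refine congrArg₂ _ ?_ ?_
    · refine (intervalIntegral.integral_add (i1 i) (i2 i)).trans ?_
      rw [intervalIntegral.integral_const_mul]; rfl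
    · refine (intervalIntegral.integral_sub (i3 i) (i4 i)).trans ?_
      rw [intervalIntegral.integral_const_mul]; rfl
  simp only [hinner]
  have hK : ∀ z : Zs n, z ∉ tsupport (fun z : Zs n => Φ (Qf z)) → Φ (Qf z) = 0 := fun z hz =>
    image_eq_zero_of_notMem_tsupport (f := fun z : Zs n => Φ (Qf z)) hz
  have hva : ∀ i, Integrable (fun z : Zs n => z.2 i * (a (asm z (Φ (Qf z))) i - a (asm z (-Φ (Qf z))) i)) := by
    intro i
    refine Continuous.integrable_of_hasCompactSupport (by fun_prop) ?_
    refine HasCompactSupport.intro hs.isCompact fun z hz => ?_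
    simp [hK z hz]
  have hvb : ∀ i, Integrable (fun z : Zs n => z.1 i * (b (asm z (Φ (Qf z))) i - b (asm z (-Φ (Qf z))) i)) := by
    intro i
    refine Continuous.integrable_of_hasCompactSupport (by fun_prop) ?_
    refine HasCompactSupport.intro hs.isCompact fun z hz => ?_
    simp [hK z hz]
  have hbd : ∀ z : Zs n, bd a b z (Φ (Qf z)) (Φ' (Qf z)) =
      ∑ i, ((-((a (asm z (Φ (Qf z))) i + a (asm z (-Φ (Qf z))) i) * (Φ' (Qf z) * (2 * z.1 i))) +
        z.2 i * (a (asm z (Φ (Qf z))) i - a (asm z (-Φ (Qf z))) i)) +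
        (-((b (asm z (Φ (Qf z))) i + b (asm z (-Φ (Qf z))) i) * (Φ' (Qf z) * (2 * z.2 i))) -
        z.1 i * (b (asm z (Φ (Qf z))) i - b (asm z (-Φ (Qf z))) i))) := by
    intro z
    refine Finset.sum_congr rfl fun i _ => ?_
    ring
  simp only [hbd]
  have l1 := fun i => ((hX i).1.add (hva i)).add ((hY i).1.sub (hvb i))
  have l2 := fun i => ((hX i).2.1.neg.add (hva i)).add ((hY i).2.1.neg.sub (hvb i))
  refine (integral_finsetSum _ fun i _ => l1 i).trans
    (Eq.trans ?_ (integral_finsetSum _ fun i _ => l2 i).symm)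
  refine Finset.sum_congr rfl fun i _ => ?_
  refine (integral_add ((hX i).1.add (hva i)) ((hY i).1.sub (hvb i))).trans
    (Eq.trans ?_ (integral_add ((hX i).2.1.neg.add (hva i)) ((hY i).2.1.neg.sub (hvb i))).symm)
  refine congrArg₂ _ ?_ ?_
  · refine (integral_add (hX i).1 (hva i)).trans (Eq.trans ?_ (integral_add (hX i).2.1.neg (hva i)).symm)
    rw [(hX i).2.2]
    congr 1
    exact (integral_neg _).symm
  · refine (integral_sub (hY i).1 (hvb i)).trans (Eq.trans ?_ (integral_sub (hY i).2.1.neg (hvb i)).symm)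
    rw [(hY i).2.2]
    congr 1
    exact (integral_neg _).symm

lemma cs_bound {a b c d : Fin n → ℝ} {K : ℝ} (h : ∑ i, (a i ^ 2 + b i ^ 2) ≤ 1)
    (hK : ∑ i, (c i ^ 2 + d i ^ 2) ≤ K ^ 2) (hK0 : 0 ≤ K) : |∑ i, (a i * c i + b i * d i)| ≤ K := by
  refine abs_le_of_sq_le_sq ?_ hK0
  have h1 := Finset.sum_mul_sq_le_sq_mul_sq Finset.univ (Sum.elim a b) (Sum.elim c d)
  simp only [Fintype.sum_sum_type, Sum.elim_inl, Sum.elim_inr, ← Finset.sum_add_distrib] at h1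
  have h2 : 0 ≤ ∑ i, (c i ^ 2 + d i ^ 2) := Finset.sum_nonneg fun i _ => by positivity
  nlinarith

lemma mf_nonneg (q : ℝ) : 0 ≤ mf lam q := by unfold mf; positivity

lemma bd_bound (hl : 0 < lam) {a b : Hei n → Fin n → ℝ}
    (h : ∀ p, ∑ i, ((a p i) ^ 2 + (b p i) ^ 2) ≤ 1) (z : Zs n) (φ d : ℝ)
    (hd : |d| ≤ |Ff' lam (Qf z)|) (hφ : 1 / lam ^ 2 ≤ Qf z → φ = 0) :
    |bd a b z φ d| ≤ 2 * mf lam (Qf z) := by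
  have hq := Qf_nonneg z
  rcases le_or_gt (1 / lam ^ 2) (Qf z) with h1 | h1
  · have hw := sqrt_eq_zero_of_nonpos (one_sub_nonpos hl h1)
    have hd0 : d = 0 := by
      simpa [Ff', hw] using hd
    have : bd a b z φ d = 0 := by
      rw [hφ h1, hd0]
      refine Finset.sum_eq_zero fun i _ => ?_
      simp only [neg_zero]
      ring
    rw [this, abs_zero]
    linarith [mf_nonneg (lam := lam) (Qf z)]
  · have hw2 := one_sub_pos hl h1
    have hw := sqrt_pos.2 hw2
    have hd2 : d ^ 2 ≤ (Ff' lam (Qf z)) ^ 2 := sq_le_sq.2 hd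
    have hF2 : (Ff' lam (Qf z)) ^ 2 = lam ^ 2 * Qf z / (4 * (1 - lam ^ 2 * Qf z)) := by
      unfold Ff'
      rw [div_pow, mul_pow, mul_pow, sq_sqrt hq, sq_sqrt hw2.le]; ring
    have hm2 : (mf lam (Qf z)) ^ 2 = Qf z / (1 - lam ^ 2 * Qf z) := by
      unfold mf
      rw [div_pow, sq_sqrt hq, sq_sqrt hw2.le]
    have hle : Qf z + 4 * d ^ 2 * Qf z ≤ (mf lam (Qf z)) ^ 2 := by
      have : (mf lam (Qf z)) ^ 2 = Qf z + 4 * (Ff' lam (Qf z)) ^ 2 * Qf z := by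
        rw [hm2, hF2]
        have hw3 := hw2.ne'
        generalize hwd : 1 - lam ^ 2 * Qf z = w at hw3
        have : lam ^ 2 * Qf z = 1 - w := by linarith
        rw [this]
        field_simp
        ring
      rw [this]
      nlinarith
    have hQ : Qf z = ∑ i, ((z.1 i) ^ 2 + (z.2 i) ^ 2) := rfl
    have k1 : ∑ i, ((z.2 i - 2 * d * z.1 i) ^ 2 + (-z.1 i - 2 * d * z.2 i) ^ 2) ≤ (mf lam (Qf z)) ^ 2 := by
      refine le_of_eq_of_le ?_ hle
      rw [hQ, Finset.mul_sum, ← Finset.sum_add_distrib]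
      refine Finset.sum_congr rfl fun i _ => ?_
      ring
    have k2 : ∑ i, ((-z.2 i - 2 * d * z.1 i) ^ 2 + (z.1 i - 2 * d * z.2 i) ^ 2) ≤ (mf lam (Qf z)) ^ 2 := by
      refine le_of_eq_of_le ?_ hle
      rw [hQ, Finset.mul_sum, ← Finset.sum_add_distrib]
      refine Finset.sum_congr rfl fun i _ => ?_
      ring
    unfold bd
    rw [Finset.sum_add_distrib]
    refine (abs_add_le _ _).trans ?_
    have c1 := cs_bound (h (asm z φ)) k1 (mf_nonneg _)
    have c2 := cs_bound (h (asm z (-φ))) k2 (mf_nonneg _)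
    linarith

/-! ### The Pansu ball -/

lemma mem_pansuBall (hl : 0 < lam) (z : Zs n) (t : ℝ) :
    asm z t ∈ pansuBall n lam ↔ Qf z ≤ 1 / lam ^ 2 ∧ |t| ≤ Ff lam (Qf z) := by
  have h1 : zNorm (asm z t) = √(Qf z) := rfl
  change zNorm (asm z t) ≤ 1 / lam ∧ |t| ≤ pansuProfile lam (zNorm (asm z t)) ↔ _
  rw [h1, sqrt_le_iff]
  have h2 : (0:ℝ) ≤ 1 / lam := by positivity
  have h3 : (1 / lam) ^ 2 = 1 / lam ^ 2 := by rw [div_pow, one_pow]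
  simp only [h2, true_and, h3]
  rfl

lemma Ff_le (hl : 0 < lam) (z : Zs n) : ∃ M, ∀ z : Zs n, Ff lam (Qf z) ≤ M := by
  obtain ⟨M, hM⟩ := ((prof_F hl).cont.comp (Qf_cont (n := n))).bounded_above_of_compact_support
    (comp_Qf_support (prof_F hl).zero)
  exact ⟨M, fun z => (le_abs_self _).trans (hM z)⟩

lemma pansuBall_compact (hl : 0 < lam) : IsCompact (pansuBall n lam) := by
  obtain ⟨M, hM⟩ := Ff_le (n := n) hl 0
  have hc : IsCompact ({z : Zs n | Qf z ≤ 1 / lam ^ 2} ×ˢ Icc (-M) M) :=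
    (Qf_bounded _).prod isCompact_Icc
  have hc2 : IsCompact (({z : Zs n | Qf z ≤ 1 / lam ^ 2} ×ˢ Icc (-M) M) ∩
      {p : Zs n × ℝ | |p.2| ≤ Ff lam (Qf p.1)}) :=
    hc.inter_right (isClosed_le (by fun_prop) ((Ff_cont.comp Qf_cont).comp continuous_fst))
  have hc3 := hc2.image (asmL n).continuous
  convert hc3 using 1
  ext p
  constructor
  · intro hp
    have h := (mem_pansuBall hl (p.1, p.2.1) p.2.2).1 hp
    exact ⟨((p.1, p.2.1), p.2.2), ⟨⟨h.1, abs_le.1 (h.2.trans (hM _))⟩, h.2⟩, rfl⟩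
  · rintro ⟨⟨z, t⟩, ⟨⟨h1, _⟩, h2⟩, rfl⟩
    exact (mem_pansuBall hl z t).2 ⟨h1, h2⟩

lemma integral_pansuBall (hl : 0 < lam) {G : Hei n → ℝ} (hG : Continuous G) :
    ∫ p in pansuBall n lam, G p =
      ∫ z : Zs n, (∫ t in (-Ff lam (Qf z))..(Ff lam (Qf z)), G (asm z t)) := by
  have hcomp := pansuBall_compact (n := n) hl
  have hm := hcomp.isClosed.measurableSet
  have hint : Integrable ((pansuBall n lam).indicator G) :=
    (hG.continuousOn.integrableOn_compact hcomp).integrable_indicator hm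
  rw [← integral_indicator hm]
  have hmp := volume_preserving_prodAssoc (α₁ := Fin n → ℝ) (β₁ := Fin n → ℝ) (γ₁ := ℝ)
  rw [← hmp.integral_comp' (g := (pansuBall n lam).indicator G)]
  have hint2 := (hmp.integrable_comp_emb (MeasurableEquiv.measurableEmbedding _)).2 hint
  rw [Measure.volume_eq_prod] at hint2 ⊢
  refine (integral_prod _ hint2).trans ?_
  congr 1 with z
  have hF := Ff_nonneg hl (Qf z)
  rw [intervalIntegral.integral_of_le (by linarith), ← integral_Icc_eq_integral_Ioc]
  rcases le_or_gt (Qf z) (1 / lam ^ 2) with h | h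
  · rw [← integral_indicator measurableSet_Icc]
    congr 1 with t
    have hiff : asm z t ∈ pansuBall n lam ↔ t ∈ Icc (-Ff lam (Qf z)) (Ff lam (Qf z)) := by
      rw [mem_pansuBall hl, mem_Icc, ← abs_le]; tauto
    change (pansuBall n lam).indicator G (asm z t) = _
    by_cases ht : t ∈ Icc (-Ff lam (Qf z)) (Ff lam (Qf z))
    · rw [indicator_of_mem ht, indicator_of_mem (hiff.2 ht)]
    · rw [indicator_of_notMem ht, indicator_of_notMem (fun h => ht (hiff.1 h))]
  · rw [Ff_zero hl _ h.le]
    have : ∀ t, (pansuBall n lam).indicator G (asm z t) = 0 := fun t =>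
      indicator_of_notMem (fun hp => absurd ((mem_pansuBall hl z t).1 hp).1 (not_le.2 h)) _
    change ∫ t, (pansuBall n lam).indicator G (asm z t) = _
    simp [this]

lemma volume_pansuBall (hl : 0 < lam) :
    volume (pansuBall n lam) = ENNReal.ofReal (2 * ∫ z : Zs n, Ff lam (Qf z)) := by
  have h := integral_pansuBall (n := n) hl (G := fun _ => 1) continuous_const
  have hfin := (pansuBall_compact (n := n) hl).measure_lt_top (μ := volume)
  simp only [integral_const, smul_eq_mul, mul_one, intervalIntegral.integral_const,
    measureReal_restrict_apply_univ] at h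
  rw [← integral_const_mul]
  have : ∀ z : Zs n, Ff lam (Qf z) - -Ff lam (Qf z) = 2 * Ff lam (Qf z) := fun z => by ring
  simp only [this] at h
  rw [← h, Measure.real, ENNReal.ofReal_toReal hfin.ne]

lemma hDiv_bounded {a b : Hei n → Fin n → ℝ} (ha : ContDiff ℝ 1 a) (hb : ContDiff ℝ 1 b)
    (hsa : HasCompactSupport a) (hsb : HasCompactSupport b) :
    ∃ C, ∀ p, ‖hDivergence a b p‖ ≤ C := by
  refine (hDiv_cont ha hb).bounded_above_of_compact_support ?_
  refine HasCompactSupport.intro (hsa.isCompact.union hsb.isCompact) fun p hp => ?_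
  rw [mem_union, not_or] at hp
  have key : ∀ (c : Hei n → Fin n → ℝ), p ∉ tsupport c → ∀ i, fderiv ℝ (fun q => c q i) p = 0 := by
    intro c hc i
    have h1 : (fun q => c q i) =ᶠ[𝓝 p] fun _ => 0 := by
      filter_upwards [(isClosed_tsupport c).isOpen_compl.mem_nhds hc] with q hq
      rw [image_eq_zero_of_notMem_tsupport hq]; rfl
    rw [h1.fderiv_eq]; simp
  simp [hDivergence, Xder, Yder, key a hp.1, key b hp.2]

lemma bd_cont {a b : Hei n → Fin n → ℝ} (ha : Continuous a) (hb : Continuous b) :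
    Continuous (fun p : Zs n × ℝ × ℝ => bd a b p.1 p.2.1 p.2.2) := by
  unfold bd
  fun_prop

lemma tendsto_two {g : ℝ → ℝ → ℝ} (hc : Continuous (fun p : ℝ × ℝ => g p.1 p.2))
    {u v : ℕ → ℝ} {x y : ℝ} (hu : Tendsto u atTop (𝓝 x)) (hv : Tendsto v atTop (𝓝 y)) :
    Tendsto (fun k => g (u k) (v k)) atTop (𝓝 (g x y)) := by
  have h1 : Tendsto (fun k => (u k, v k)) atTop (𝓝 (x, y)) := hu.prodMk_nhds hv
  exact (hc.tendsto (x, y)).comp h1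

lemma bd_tendsto {a b : Hei n → Fin n → ℝ} (ha : Continuous a) (hb : Continuous b) (z : Zs n)
    {u v : ℕ → ℝ} {x y : ℝ} (hu : Tendsto u atTop (𝓝 x)) (hv : Tendsto v atTop (𝓝 y)) :
    Tendsto (fun k => bd a b z (u k) (v k)) atTop (𝓝 (bd a b z x y)) := by
  have hc : Continuous (fun p : ℝ × ℝ => bd a b z p.1 p.2) := by
    unfold bd
    fun_prop
  exact tendsto_two (g := fun x y => bd a b z x y) hc hu hv

lemma slab_joint {G : Hei n → ℝ} (hG : Continuous G) :
    Continuous (fun p : Zs n × ℝ => ∫ t in (-p.2)..p.2, G (asm p.1 t)) := by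
  have hf : Continuous (Function.uncurry fun (p : Zs n × ℝ) (t : ℝ) => G (asm p.1 t)) :=
    hG.comp (f := fun q : (Zs n × ℝ) × ℝ => asm q.1.1 q.2) (by fun_prop)
  have h1 := intervalIntegral.continuous_parametric_intervalIntegral_of_continuous (μ := volume)
    (a₀ := 0) hf (s := fun p => p.2) (by fun_prop)
  have h2 := intervalIntegral.continuous_parametric_intervalIntegral_of_continuous (μ := volume)
    (a₀ := 0) hf (s := fun p => -p.2) (by fun_prop)
  refine (h1.sub h2).congr fun p => ?_
  have ii : ∀ x y : ℝ, IntervalIntegrable (fun t => G (asm p.1 t)) volume x y := fun x y =>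
    (hG.comp (by fun_prop)).intervalIntegrable x y
  exact intervalIntegral.integral_interval_sub_left (ii _ _) (ii _ _)

/-- Gauss-Green formula on the Pansu ball. -/
lemma gauss_green (hl : 0 < lam) {a b : Hei n → Fin n → ℝ} (hab : IsAdmissible Set.univ a b) :
    ∫ p in pansuBall n lam, hDivergence a b p =
      ∫ z : Zs n, bd a b z (Ff lam (Qf z)) (Ff' lam (Qf z)) := by
  obtain ⟨ha, hb, hsa, hsb, -, -, h1⟩ := hab
  have hP := prof_F hl
  have hdc := hDiv_cont ha hb
  obtain ⟨C, hC⟩ := hDiv_bounded ha hb hsa hsb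
  have hC0 : 0 ≤ C := (norm_nonneg _).trans (hC 0)
  have hbc := bd_cont ha.continuous hb.continuous
  rw [integral_pansuBall hl hdc]
  have hk := fun k => slab_div (R2 := 1 / lam ^ 2) ha hb (hP.tr_contDiff (ep_pos k))
    (hP.tr_hasDerivAt (ep_pos k)) (hP.tr_zero (ep_pos k))
  have hjoint := slab_joint hdc
  have hprim : ∀ z : Zs n, Continuous (fun s : ℝ => ∫ t in (-s)..s, hDivergence a b (asm z t)) :=
    fun z => hjoint.comp (f := fun s : ℝ => (z, s)) (by fun_prop)
  have L : Tendsto (fun k => ∫ z : Zs n, (∫ t in (-tr (ep k) (Ff lam) (Qf z))..(tr (ep k) (Ff lam) (Qf z)),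
      hDivergence a b (asm z t))) atTop
      (𝓝 (∫ z : Zs n, (∫ t in (-Ff lam (Qf z))..(Ff lam (Qf z)), hDivergence a b (asm z t)))) := by
    refine tendsto_integral_of_dominated_convergence (fun z => C * (2 * Ff lam (Qf z))) (fun k => ?_)
      ((hP.integrable.const_mul 2).const_mul C)
      (fun k => ae_of_all _ fun z => ?_)
      (ae_of_all _ fun z => ((hprim z).tendsto _).comp (hP.tr_tendsto _))
    · refine Continuous.aestronglyMeasurable ?_
      have t1 := (hP.tr_contDiff (ep_pos k)).continuous
      exact hjoint.comp (f := fun z : Zs n => (z, tr (ep k) (Ff lam) (Qf z))) (by fun_prop)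
    · refine (intervalIntegral.norm_integral_le_of_norm_le_const fun t _ => hC _).trans ?_
      refine mul_le_mul_of_nonneg_left ?_ hC0
      have e1 := chi_le (ep_pos k) (hP.nonneg (Qf z))
      have e2 := chi_nonneg (ep_pos k) (Ff lam (Qf z))
      unfold tr
      rw [abs_of_nonneg (by linarith)]
      linarith
  have R : Tendsto (fun k => ∫ z : Zs n, bd a b z (tr (ep k) (Ff lam) (Qf z))
      (tr' (ep k) (Ff lam) (Ff' lam) (Qf z))) atTop
      (𝓝 (∫ z : Zs n, bd a b z (Ff lam (Qf z)) (Ff' lam (Qf z)))) := by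
    refine tendsto_integral_of_dominated_convergence (fun z => 2 * mf lam (Qf z)) (fun k => ?_)
      ((m_integrable hl).const_mul 2)
      (fun k => ae_of_all _ fun z => ?_) (ae_of_all _ fun z => ?_)
    · refine Continuous.aestronglyMeasurable ?_
      have t1 := (hP.tr_contDiff (ep_pos k)).continuous
      have t2 := hP.tr'_cont (ep_pos k)
      exact hbc.comp (f := fun z : Zs n => (z, tr (ep k) (Ff lam) (Qf z),
        tr' (ep k) (Ff lam) (Ff' lam) (Qf z))) (by fun_prop)
    · exact bd_bound hl h1 z _ _ (tr'_abs_le (ep_pos k) _) (hP.tr_zero (ep_pos k) _)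
    · exact bd_tendsto ha.continuous hb.continuous z (hP.tr_tendsto _) (hP.tr'_tendsto _)
  simp only [hk] at L
  exact tendsto_nhds_unique L R

end PartD

section PartE

variable {n : ℕ} {lam : ℝ}

lemma hDiv_le (hl : 0 < lam) {a b : Hei n → Fin n → ℝ} (hab : IsAdmissible Set.univ a b) :
    ∫ p in pansuBall n lam, hDivergence a b p ≤ 2 * ∫ z : Zs n, mf lam (Qf z) := by
  rw [gauss_green hl hab, ← integral_const_mul]
  refine (le_abs_self _).trans ?_
  rw [← Real.norm_eq_abs]
  exact norm_integral_le_of_norm_le ((m_integrable hl).const_mul 2) (ae_of_all _ fun z =>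
    bd_bound hl hab.2.2.2.2.2.2 z _ _ le_rfl (Ff_zero hl _))

def etaK (lam : ℝ) (k : ℕ) (q : ℝ) : ℝ :=
  smoothTransition (k * q - 1) * smoothTransition (k * (1 / lam ^ 2 - q) - 1)

def cK (lam : ℝ) (k : ℕ) (q : ℝ) : ℝ := etaK lam k q * (√(1 - lam ^ 2 * q) / √q)

def psiK (k : ℕ) (t : ℝ) : ℝ := t / √(t ^ 2 + ep k)

def tauK (k : ℕ) (t : ℝ) : ℝ := smoothTransition (k + 1 - t ^ 2)

lemma etaK_zero_left {k : ℕ} {q : ℝ} (h : k * q - 1 ≤ 0) : etaK lam k q = 0 := by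
  rw [etaK, smoothTransition.zero_of_nonpos h, zero_mul]

lemma etaK_zero_right {k : ℕ} {q : ℝ} (h : k * (1 / lam ^ 2 - q) - 1 ≤ 0) : etaK lam k q = 0 := by
  rw [etaK, smoothTransition.zero_of_nonpos h, mul_zero]

lemma etaK_zero {k : ℕ} {q : ℝ} (h : q ≤ 0 ∨ 1 / lam ^ 2 ≤ q) : etaK lam k q = 0 := by
  have hk : (0:ℝ) ≤ k := Nat.cast_nonneg k
  rcases h with h | h
  · exact etaK_zero_left (by nlinarith)
  · exact etaK_zero_right (by nlinarith)

lemma etaK_nonneg (k : ℕ) (q : ℝ) : 0 ≤ etaK lam k q :=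
  mul_nonneg (smoothTransition.nonneg _) (smoothTransition.nonneg _)

lemma etaK_le_one (k : ℕ) (q : ℝ) : etaK lam k q ≤ 1 :=
  mul_le_one₀ (smoothTransition.le_one _) (smoothTransition.nonneg _) (smoothTransition.le_one _)

@[fun_prop]
lemma etaK_contDiff (k : ℕ) : ContDiff ℝ 1 (etaK lam k) := by
  have h : ContDiff ℝ 1 smoothTransition := smoothTransition.contDiff
  unfold etaK
  exact (h.comp (by fun_prop)).mul (h.comp (by fun_prop))

@[fun_prop]
lemma tauK_contDiff (k : ℕ) : ContDiff ℝ 1 (tauK k) := by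
  have h : ContDiff ℝ 1 smoothTransition := smoothTransition.contDiff
  unfold tauK
  exact (h.comp (by fun_prop))

lemma psi_pos (k : ℕ) (t : ℝ) : 0 < t ^ 2 + ep k := by
  have := ep_pos k
  positivity

@[fun_prop]
lemma psiK_contDiff (k : ℕ) : ContDiff ℝ 1 (psiK k) := by
  unfold psiK
  refine ContDiff.div (by fun_prop) (ContDiff.sqrt (by fun_prop) fun t => (psi_pos k t).ne') fun t => ?_
  exact (sqrt_pos.2 (psi_pos k t)).ne'

lemma psiK_neg (k : ℕ) (t : ℝ) : psiK k (-t) = - psiK k t := by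
  unfold psiK; rw [neg_sq, neg_div]

lemma psiK_sq_le (k : ℕ) (t : ℝ) : psiK k t ^ 2 ≤ 1 := by
  unfold psiK
  rw [div_pow, sq_sqrt (psi_pos k t).le, div_le_one (psi_pos k t)]
  linarith [ep_pos k]

lemma tauK_neg (k : ℕ) (t : ℝ) : tauK k (-t) = tauK k t := by
  unfold tauK; rw [neg_sq]

@[fun_prop]
lemma cK_contDiff (hl : 0 < lam) (k : ℕ) : ContDiff ℝ 1 (cK lam k) := by
  rw [contDiff_iff_contDiffAt]
  intro q
  have hz : ∀ q', etaK lam k =ᶠ[𝓝 q'] (fun _ => 0) → ContDiffAt ℝ 1 (cK lam k) q' := by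
    intro q' h
    refine (contDiffAt_const (c := (0:ℝ))).congr_of_eventuallyEq ?_
    filter_upwards [h] with x hx
    rw [cK, hx, zero_mul]
  rcases le_or_gt q 0 with h0 | h0
  · refine hz q ?_
    have : ∀ᶠ x in 𝓝 q, (k:ℝ) * x - 1 < 0 := by
      refine ContinuousAt.eventually_lt (by fun_prop) continuousAt_const ?_
      have hk : (0:ℝ) ≤ k := Nat.cast_nonneg k
      nlinarith
    filter_upwards [this] with x hx
    exact etaK_zero_left hx.le
  rcases le_or_gt (1 / lam ^ 2) q with h1 | h1
  · refine hz q ?_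
    have : ∀ᶠ x in 𝓝 q, (k:ℝ) * (1 / lam ^ 2 - x) - 1 < 0 := by
      refine ContinuousAt.eventually_lt (by fun_prop) continuousAt_const ?_
      have hk : (0:ℝ) ≤ k := Nat.cast_nonneg k
      nlinarith
    filter_upwards [this] with x hx
    exact etaK_zero_right hx.le
  · unfold cK
    refine (etaK_contDiff k).contDiffAt.mul (ContDiffAt.div ?_ ?_ (sqrt_pos.2 h0).ne')
    · exact ContDiffAt.sqrt (by fun_prop) (one_sub_pos hl h1).ne'
    · exact ContDiffAt.sqrt (by fun_prop) h0.ne'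

def Qh (p : Hei n) : ℝ := Qf (n := n) (p.1, p.2.1)

@[fun_prop]
lemma Qh_contDiff : ContDiff ℝ 1 (Qh (n := n)) := by
  unfold Qh Qf; fun_prop

def fa (lam : ℝ) (k : ℕ) (p : Hei n) (i : Fin n) : ℝ :=
  tauK k p.2.2 * (etaK lam k (Qh p) * lam * p.1 i + psiK k p.2.2 * cK lam k (Qh p) * p.2.1 i)

def fb (lam : ℝ) (k : ℕ) (p : Hei n) (i : Fin n) : ℝ :=
  tauK k p.2.2 * (etaK lam k (Qh p) * lam * p.2.1 i - psiK k p.2.2 * cK lam k (Qh p) * p.1 i)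

lemma coef_contDiff (hl : 0 < lam) (k : ℕ) :
    ContDiff ℝ 1 (fun p : Hei n => tauK k p.2.2) ∧ ContDiff ℝ 1 (fun p : Hei n => psiK k p.2.2) ∧
    ContDiff ℝ 1 (fun p : Hei n => etaK lam k (Qh p)) ∧
    ContDiff ℝ 1 (fun p : Hei n => cK lam k (Qh p)) :=
  ⟨(tauK_contDiff k).comp (by fun_prop), (psiK_contDiff k).comp (by fun_prop),
    (etaK_contDiff k).comp Qh_contDiff, (cK_contDiff hl k).comp Qh_contDiff⟩

lemma field_support {f : Hei n → Fin n → ℝ} {M R : ℝ}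
    (h : ∀ p, f p ≠ 0 → Qh p ≤ R ∧ p.2.2 ∈ Icc (-M) M) : HasCompactSupport f := by
  have hc : IsCompact ({z : Zs n | Qf z ≤ R} ×ˢ Icc (-M) M) :=
    (Qf_bounded _).prod isCompact_Icc
  refine HasCompactSupport.intro (hc.image (asmL n).continuous) fun p hp => ?_
  by_contra hne
  exact hp ⟨((p.1, p.2.1), p.2.2), h p hne, rfl⟩

lemma cK_sq (hl : 0 < lam) (k : ℕ) {q : ℝ} :
    (cK lam k q) ^ 2 * q = etaK lam k q ^ 2 * (1 - lam ^ 2 * q) := by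
  rcases le_or_gt q 0 with h0 | h0
  · simp [cK, etaK_zero (lam := lam) (k := k) (Or.inl h0)]
  rcases le_or_gt (1 / lam ^ 2) q with h1 | h1
  · simp only [cK, etaK_zero (lam := lam) (k := k) (Or.inr h1)]; ring
  · rw [cK, mul_pow, div_pow, sq_sqrt (one_sub_pos hl h1).le, sq_sqrt h0.le]
    field_simp

lemma field_zero (hl : 0 < lam) (k : ℕ) (p : Hei n) (h : fa lam k p ≠ 0 ∨ fb lam k p ≠ 0) :
    Qh p ≤ 1 / lam ^ 2 ∧ p.2.2 ∈ Icc (-((k:ℝ) + 1)) (k + 1) := by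
  constructor
  · by_contra h1
    have e := etaK_zero (lam := lam) (k := k) (Or.inr (not_le.1 h1).le)
    have ea : fa lam k p = 0 := by ext i; simp [fa, cK, e]
    have eb : fb lam k p = 0 := by ext i; simp [fb, cK, e]
    simp [ea, eb] at h
  · by_contra h1
    have e : tauK k p.2.2 = 0 := by
      refine smoothTransition.zero_of_nonpos ?_
      rw [mem_Icc, ← abs_le, not_le] at h1
      have hk : (0:ℝ) ≤ k := Nat.cast_nonneg k
      rw [← sq_abs]
      nlinarith
    have ea : fa lam k p = 0 := by ext i; simp [fa, e]
    have eb : fb lam k p = 0 := by ext i; simp [fb, e]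
    simp [ea, eb] at h

lemma field_admissible (hl : 0 < lam) (k : ℕ) :
    IsAdmissible (n := n) Set.univ (fa lam k) (fb lam k) := by
  obtain ⟨c1, c2, c3, c4⟩ := coef_contDiff (n := n) hl k
  refine ⟨?_, ?_, field_support fun p hp => field_zero hl k p (Or.inl hp),
    field_support fun p hp => field_zero hl k p (Or.inr hp), subset_univ _, subset_univ _, fun p => ?_⟩
  · refine contDiff_pi.2 fun i => ?_
    exact c1.mul (((c3.mul contDiff_const).mul (by fun_prop)).add ((c2.mul c4).mul (by fun_prop)))
  · refine contDiff_pi.2 fun i => ?_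
    exact c1.mul (((c3.mul contDiff_const).mul (by fun_prop)).sub ((c2.mul c4).mul (by fun_prop)))
  · have e : ∑ i, ((fa lam k p i) ^ 2 + (fb lam k p i) ^ 2) =
        tauK k p.2.2 ^ 2 * (etaK lam k (Qh p) ^ 2 * lam ^ 2 + psiK k p.2.2 ^ 2 * cK lam k (Qh p) ^ 2) *
          Qh p := by
      have hQ : Qh p = ∑ i, ((p.1 i) ^ 2 + (p.2.1 i) ^ 2) := rfl
      conv_rhs => rw [hQ, Finset.mul_sum]
      rw [← hQ]
      refine Finset.sum_congr rfl fun i _ => ?_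
      unfold fa fb
      ring
    rw [e]
    have hc := cK_sq hl k (q := Qh p)
    have e2 : tauK k p.2.2 ^ 2 * (etaK lam k (Qh p) ^ 2 * lam ^ 2 + psiK k p.2.2 ^ 2 * cK lam k (Qh p) ^ 2) *
          Qh p = tauK k p.2.2 ^ 2 * (etaK lam k (Qh p) ^ 2 * (lam ^ 2 * Qh p +
            psiK k p.2.2 ^ 2 * (1 - lam ^ 2 * Qh p))) := by
      linear_combination (tauK k p.2.2 ^ 2 * psiK k p.2.2 ^ 2) * hc
    rw [e2]
    have hq : 0 ≤ Qh p := Qf_nonneg _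
    rcases le_or_gt (1 / lam ^ 2) (Qh p) with h1 | h1
    · rw [etaK_zero (Or.inr h1)]; simp
    have hw := one_sub_pos hl h1
    have t1 : tauK k p.2.2 ^ 2 ≤ 1 :=
      pow_le_one₀ (smoothTransition.nonneg _) (smoothTransition.le_one _)
    have t2 : etaK lam k (Qh p) ^ 2 ≤ 1 := pow_le_one₀ (etaK_nonneg _ _) (etaK_le_one _ _)
    have t3 := psiK_sq_le k p.2.2
    have t4 : lam ^ 2 * Qh p + psiK k p.2.2 ^ 2 * (1 - lam ^ 2 * Qh p) ≤ 1 := by nlinarith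
    have t5 : 0 ≤ lam ^ 2 * Qh p + psiK k p.2.2 ^ 2 * (1 - lam ^ 2 * Qh p) := by positivity
    exact mul_le_one₀ t1 (by positivity) (mul_le_one₀ t2 t5 t4)

lemma bd_field (k : ℕ) (z : Zs n) (φ d : ℝ) :
    bd (fa lam k) (fb lam k) z φ d =
      2 * tauK k φ * (-2 * d * etaK lam k (Qf z) * lam + psiK k φ * cK lam k (Qf z)) * Qf z := by
  have hQ : Qf z = ∑ i, ((z.1 i) ^ 2 + (z.2 i) ^ 2) := rfl
  have hh : ∀ t, Qh (asm z t) = Qf z := fun t => rfl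
  conv_rhs => rw [hQ, Finset.mul_sum]
  rw [← hQ]
  refine Finset.sum_congr rfl fun i _ => ?_
  unfold fa fb
  rw [hh, hh]
  change (tauK k φ * (etaK lam k (Qf z) * lam * z.1 i + psiK k φ * cK lam k (Qf z) * z.2 i) * (z.2 i - 2 * d * z.1 i) +
      tauK k φ * (etaK lam k (Qf z) * lam * z.2 i - psiK k φ * cK lam k (Qf z) * z.1 i) * (-z.1 i - 2 * d * z.2 i)) +
    (tauK k (-φ) * (etaK lam k (Qf z) * lam * z.1 i + psiK k (-φ) * cK lam k (Qf z) * z.2 i) * (-z.2 i - 2 * d * z.1 i) +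
      tauK k (-φ) * (etaK lam k (Qf z) * lam * z.2 i - psiK k (-φ) * cK lam k (Qf z) * z.1 i) * (z.1 i - 2 * d * z.2 i)) = _
  rw [psiK_neg, tauK_neg]
  ring

lemma etaK_tendsto {q : ℝ} (h0 : 0 < q) (h1 : q < 1 / lam ^ 2) :
    Tendsto (fun k => etaK lam k q) atTop (𝓝 1) := by
  refine tendsto_const_nhds.congr' ?_
  have a1 := (tendsto_natCast_atTop_atTop (R := ℝ)).atTop_mul_const h0
  have a2 := (tendsto_natCast_atTop_atTop (R := ℝ)).atTop_mul_const (sub_pos.2 h1)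
  filter_upwards [a1.eventually_ge_atTop 2, a2.eventually_ge_atTop 2] with k h2 h3
  rw [etaK, smoothTransition.one_of_one_le (by linarith), smoothTransition.one_of_one_le (by linarith),
    mul_one]

lemma tauK_tendsto (t : ℝ) : Tendsto (fun k => tauK k t) atTop (𝓝 1) := by
  refine tendsto_const_nhds.congr' ?_
  filter_upwards [(tendsto_natCast_atTop_atTop (R := ℝ)).eventually_ge_atTop (t ^ 2)] with k h
  rw [tauK, smoothTransition.one_of_one_le (by linarith)]

lemma psiK_tendsto {t : ℝ} (h : 0 < t) : Tendsto (fun k => psiK k t) atTop (𝓝 1) := by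
  have h1 : Tendsto (fun k => t / √(t ^ 2 + ep k)) atTop (𝓝 (t / √(t ^ 2 + 0))) := by
    refine tendsto_const_nhds.div ((continuous_sqrt.tendsto _).comp (tendsto_const_nhds.add ep_tendsto)) ?_
    rw [add_zero, sqrt_sq h.le]; exact h.ne'
  rwa [add_zero, sqrt_sq h.le, div_self h.ne'] at h1

lemma bd_field_tendsto (hl : 0 < lam) (z : Zs n) :
    Tendsto (fun k => bd (fa lam k) (fb lam k) z (Ff lam (Qf z)) (Ff' lam (Qf z))) atTop
      (𝓝 (2 * mf lam (Qf z))) := by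
  simp only [bd_field]
  rcases (Qf_nonneg z).eq_or_lt with h0 | h0
  · rw [← h0]
    simp [mf]
  rcases le_or_gt (1 / lam ^ 2) (Qf z) with h1 | h1
  · have : mf lam (Qf z) = 0 := by simp [mf, sqrt_eq_zero_of_nonpos (one_sub_nonpos hl h1)]
    rw [this]
    simp [cK, etaK_zero (lam := lam) (Or.inr h1)]
  · have hw2 := one_sub_pos hl h1
    have hw := sqrt_pos.2 hw2
    have hs := sqrt_pos.2 h0
    have hww := sq_sqrt hw2.le
    have hss := sq_sqrt h0.le
    have e1 := etaK_tendsto h0 h1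
    have e2 : Tendsto (fun k => cK lam k (Qf z)) atTop (𝓝 (1 * (√(1 - lam ^ 2 * Qf z) / √(Qf z)))) :=
      e1.mul_const _
    have e3 := tauK_tendsto (Ff lam (Qf z))
    have e4 := psiK_tendsto (Ff_pos hl (Qf z) h1)
    have e5 := ((e3.const_mul 2).mul (((e1.const_mul (-2 * Ff' lam (Qf z))).mul_const lam).add
      (e4.mul e2))).mul_const (Qf z)
    convert e5 using 2
    unfold mf Ff'
    generalize √(1 - lam ^ 2 * Qf z) = w at *
    have h3 : 1 = w ^ 2 + lam ^ 2 * Qf z := by linarith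
    generalize √(Qf z) = s at *
    rw [← hss] at h3 ⊢
    field_simp
    linear_combination h3

lemma field_tendsto (hl : 0 < lam) :
    Tendsto (fun k => ∫ p in pansuBall n lam, hDivergence (fa lam k) (fb lam k) p) atTop
      (𝓝 (2 * ∫ z : Zs n, mf lam (Qf z))) := by
  have hA := fun k => field_admissible (n := n) hl k
  simp only [fun k => gauss_green hl (hA k)]
  rw [← integral_const_mul]
  refine tendsto_integral_of_dominated_convergence (fun z => 2 * mf lam (Qf z)) (fun k => ?_)
    ((m_integrable hl).const_mul 2)
    (fun k => ae_of_all _ fun z => bd_bound hl (hA k).2.2.2.2.2.2 z _ _ le_rfl (Ff_zero hl _))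
    (ae_of_all _ fun z => bd_field_tendsto hl z)
  have m1 : Measurable (fun z : Zs n => Ff lam (Qf z)) := (Ff_cont.comp Qf_cont).measurable
  have m2 : Measurable (fun z : Zs n => Ff' lam (Qf z)) := (prof_F hl).measurable'.comp Qf_cont.measurable
  have hbc := (bd_cont (hA k).1.continuous (hA k).2.1.continuous).measurable
  exact (Measurable.comp hbc (measurable_id.prodMk (m1.prodMk m2))).aestronglyMeasurable

lemma hPerimeter_pansuBall (hl : 0 < lam) :
    hPerimeter (pansuBall n lam) Set.univ = ENNReal.ofReal (2 * ∫ z : Zs n, mf lam (Qf z)) := by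
  refine le_antisymm (iSup_le fun ab => ENNReal.ofReal_le_ofReal (hDiv_le hl ab.2)) ?_
  refine le_of_tendsto' ((ENNReal.continuous_ofReal.tendsto _).comp (field_tendsto (n := n) hl)) fun k => ?_
  exact le_iSup (fun ab : {ab : (Hei n → Fin n → ℝ) × (Hei n → Fin n → ℝ) //
      IsAdmissible Set.univ ab.1 ab.2} =>
    ENNReal.ofReal (∫ p in pansuBall n lam, hDivergence ab.1.1 ab.1.2 p))
    ⟨(fa lam k, fb lam k), field_admissible hl k⟩

end PartE

/-- The Pansu ball satisfies
`(2n+1)·P(B_λ) = 2n(2n+2)·λ·|B_λ|`: the sphere `S_λ` is critical for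
`Area − 2nλ·Volume` under Heisenberg dilations. -/
theorem pansuBall_perimeter_volume_identity
    (n : ℕ) (hn : 1 ≤ n) (lam : ℝ) (hlam : 0 < lam) :
    ((2 * n + 1 : ℕ) : ℝ≥0∞) * hPerimeter (pansuBall n lam) Set.univ
      = ENNReal.ofReal ((2 * n) * (2 * n + 2) * lam) * volume (pansuBall n lam) := by
  rw [hPerimeter_pansuBall hlam, volume_pansuBall hlam, ← ENNReal.ofReal_natCast,
    ← ENNReal.ofReal_mul (by positivity), ← ENNReal.ofReal_mul (by positivity)]
  congr 1
  have h := area_volume (n := n) hlam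
  push_cast
  linear_combination 2 * h

end
end
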